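/- arXiv:math/0303228 — 7 statements merged into one kernel-verified Lean document; each statement's English description precedes it below -/
import Mathlib

section
/- Let Φ : ℝ^N → ℝ^r be the linear map whose columns are φ_1,…,φ_N ∈ ℝ^r, and let z ∈ ℝ^r satisfy ⟨φ_k, z⟩ > 0 for every k. Let μ be the pushforward under Φ of Lebesgue measure on ℝ^N restricted to the nonnegative orthant ℝ_{≥0}^N. Then the function a ↦ exp(−⟨a, z⟩) is integrable with respect to μ and ∫_{ℝ^r} exp(−⟨a, z⟩) dμ(a) = ∏_{k=1}^N ⟨φ_k, z⟩^{−1}. -/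
open MeasureTheory

theorem integrableOn_exp_neg_mul_Ici {b : ℝ} (hb : 0 < b) :
    IntegrableOn (fun t : ℝ => Real.exp (-b * t)) (Set.Ici 0) :=
  (integrableOn_Ici_iff_integrableOn_Ioi).2 (exp_neg_integrableOn_Ioi 0 hb)

theorem integral_exp_neg_mul_Ici {b : ℝ} (hb : 0 < b) :
    ∫ t in Set.Ici (0 : ℝ), Real.exp (-b * t) = b⁻¹ := by
  rw [integral_Ici_eq_integral_Ioi, integral_exp_mul_Ioi (neg_lt_zero.2 hb)]
  simp

theorem volume_restrict_nonneg_eq_pi (ι : Type*) [Fintype ι] :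
    (volume : Measure (ι → ℝ)).restrict {x | ∀ k, 0 ≤ x k} =
      Measure.pi fun _ => volume.restrict (Set.Ici 0) := by
  rw [← Measure.restrict_pi_pi, volume_pi]
  congr 1
  ext x
  simp [Pi.le_def]

theorem exp_neg_sum_comp_eq_prod {ι κ : Type*} [Fintype ι] [Fintype κ]
    (φ : κ → ι → ℝ) (z : ι → ℝ) (x : κ → ℝ) :
    Real.exp (-∑ i, (∑ k, x k • φ k) i * z i) =
      ∏ k, Real.exp (-(∑ i, φ k i * z i) * x k) := by
  rw [← Real.exp_sum]
  simp only [Finset.sum_apply, Pi.smul_apply, smul_eq_mul, Finset.sum_mul, neg_mul,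
    Finset.sum_neg_distrib]
  rw [Finset.sum_comm]
  simp only [mul_comm, mul_left_comm]

/-- the Laplace transform formula
`∫_{C(Φ)} v(Φ,a) e^{-⟨a,z⟩} da = 1 / ∏_k ⟨φ_k, z⟩`, phrased via the pushforward `μ`
of Lebesgue measure on the nonnegative orthant under `x ↦ Σ x_k φ_k`. -/
theorem volume_laplace_transform
    {r N : ℕ} (φ : Fin N → (Fin r → ℝ)) (z : Fin r → ℝ)
    (hz : ∀ k, 0 < ∑ i, φ k i * z i) :
    Integrable (fun a : Fin r → ℝ => Real.exp (-∑ i, a i * z i))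
      (Measure.map (fun x : Fin N → ℝ => ∑ k, x k • φ k)
        (volume.restrict {x : Fin N → ℝ | ∀ k, 0 ≤ x k})) ∧
    (∫ a : Fin r → ℝ, Real.exp (-∑ i, a i * z i)
        ∂(Measure.map (fun x : Fin N → ℝ => ∑ k, x k • φ k)
          (volume.restrict {x : Fin N → ℝ | ∀ k, 0 ≤ x k})))
      = ∏ k, (∑ i, φ k i * z i)⁻¹ := by
  have hmap : Continuous fun x : Fin N → ℝ => ∑ k, x k • φ k := by fun_prop
  have hexp : Continuous fun a : Fin r → ℝ => Real.exp (-∑ i, a i * z i) := by fun_prop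
  rw [integrable_map_measure hexp.aestronglyMeasurable hmap.aemeasurable,
    integral_map hmap.aemeasurable hexp.aestronglyMeasurable, volume_restrict_nonneg_eq_pi]
  simp only [Function.comp_def, exp_neg_sum_comp_eq_prod]
  constructor
  · exact Integrable.fintype_prod fun k => integrableOn_exp_neg_mul_Ici (hz k)
  · rw [integral_fintype_prod_eq_prod (fun k t => Real.exp (-(∑ i, φ k i * z i) * t))]
    exact Finset.prod_congr rfl fun k _ => integral_exp_neg_mul_Ici (hz k)
end

section
/- Let K be a field of characteristic zero, R = K[z_1,…,z_r], F the field of fractions of R, and Δ a finite set of nonzero linear forms (homogeneous degree-one polynomials) spanning the K-vector space of linear forms. Let R_Δ ⊆ F be the K-subspace of all elements of the form P / ∏_{φ∈Δ} φ^{n_φ} with P ∈ R and n_φ ∈ ℕ, and let S_Δ be the K-span of the elements f_σ = (∏_{φ∈σ} φ)^{−1}, where σ ranges over the basic subsets of Δ (subsets that are bases of the space of linear forms). Let ∂_1,…,∂_r be the partial derivatives, extended from R to F by the quotient rule (so that ∂_i(R_Δ) ⊆ R_Δ). Then R_Δ is the internal direct sum of S_Δ and Σ_{i=1}^r ∂_i(R_Δ):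 that is, R_Δ = S_Δ + Σ_{i=1}^r ∂_i(R_Δ) and S_Δ ∩ (Σ_{i=1}^r ∂_i(R_Δ)) = {0}. -/
open MvPolynomial

noncomputable section

variable {r : ℕ} (K : Type*) [Field K] (F : Type*) [Field F]
  [Algebra (MvPolynomial (Fin r) K) F] [Algebra K F]
  [IsScalarTower K (MvPolynomial (Fin r) K) F]

/-- `R_Δ`: the space of rational functions of the form `P / ∏_{φ ∈ Δ} φ^{n_φ}`. -/
def Rdelta (Δ : Finset (MvPolynomial (Fin r) K)) : Submodule K F :=
  Submodule.span K {f : F |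
    ∃ (P : MvPolynomial (Fin r) K) (nn : MvPolynomial (Fin r) K → ℕ),
      f = algebraMap (MvPolynomial (Fin r) K) F P /
        ∏ φ ∈ Δ, (algebraMap (MvPolynomial (Fin r) K) F φ) ^ (nn φ)}

/-- A finite set of linear forms is basic if it is a basis of the space of
homogeneous degree-one polynomials. -/
def IsBasicSubset (σ : Finset (MvPolynomial (Fin r) K)) : Prop :=
  LinearIndependent K (Subtype.val : {x // x ∈ σ} → MvPolynomial (Fin r) K) ∧
  ∀ ψ : MvPolynomial (Fin r) K, ψ.IsHomogeneous 1 →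
    ψ ∈ Submodule.span K (σ : Set (MvPolynomial (Fin r) K))

/-- `S_Δ`: the span of the simple fractions `f_σ = 1/∏_{φ ∈ σ} φ` over basic subsets `σ ⊆ Δ`. -/
def Sdelta (Δ : Finset (MvPolynomial (Fin r) K)) : Submodule K F :=
  Submodule.span K {f : F | ∃ σ : Finset (MvPolynomial (Fin r) K),
    (σ : Set (MvPolynomial (Fin r) K)) ⊆ (Δ : Set (MvPolynomial (Fin r) K)) ∧
    IsBasicSubset K σ ∧
    f = (∏ φ ∈ σ, algebraMap (MvPolynomial (Fin r) K) F φ)⁻¹}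

section CombinatorialCore

open Finset

variable {k : Type*} [Field k] {L : Type*} [Field L] [Algebra k L]

/-- The Laurent monomial `∏ i, (b i) ^ (m i)` in the linear forms `b i`, where a vector
`v : Fin n → k` stands for the linear form `∑ j, v j • x j`. -/
def laurentMonomial (k : Type*) [Field k] {L : Type*} [Field L] [Algebra k L] {n : ℕ}
    (x : Fin n → L) (b : Fin n → Fin n → k) (m : Fin n → ℤ) : L :=
  ∏ i, Fintype.linearCombination k x (b i) ^ m i

/-- The span of the simple fractions `∏ i, (b i)⁻¹` over all bases `b` of the linear forms. -/
def simpleFractionSpan (k : Type*) [Field k] {L : Type*} [Field L] [Algebra k L] {n : ℕ}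
    (x : Fin n → L) : Submodule k L :=
  Submodule.span k {f | ∃ b : Fin n → Fin n → k, LinearIndependent k b ∧
    f = laurentMonomial k x b fun _ => -1}

/-- The span of all Laurent monomials in bases of linear forms which are not simple fractions. -/
def nonsimpleMonomialSpan (k : Type*) [Field k] {L : Type*} [Field L] [Algebra k L] {n : ℕ}
    (x : Fin n → L) : Submodule k L :=
  Submodule.span k {f | ∃ (b : Fin n → Fin n → k) (m : Fin n → ℤ), LinearIndependent k b ∧
    (m ≠ fun _ => -1) ∧ f = laurentMonomial k x b m}

/-- The Laurent expansion of a rational function at the point `β`. -/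
def laurentExpansion (β : L) : RatFunc L →+* LaurentSeries L :=
  RatFunc.liftRingHom
    (((HahnSeries.ofPowerSeries ℤ L).comp Polynomial.coeToPowerSeries.ringHom).comp
      (Polynomial.taylorAlgHom β).toRingHom)
    (nonZeroDivisors_le_comap_nonZeroDivisors_of_injective _ (by
      refine HahnSeries.ofPowerSeries_injective.comp (Function.Injective.comp ?_ ?_)
      · exact Polynomial.coe_injective L
      · exact Polynomial.taylor_injective β))

lemma laurentExpansion_C (β a : L) : laurentExpansion β (RatFunc.C a) = HahnSeries.C a := by
  rw [← RatFunc.algebraMap_C, laurentExpansion, RatFunc.liftRingHom_algebraMap]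
  simp

lemma laurentExpansion_X (β : L) :
    laurentExpansion β RatFunc.X = HahnSeries.C β + HahnSeries.single 1 1 := by
  rw [← RatFunc.algebraMap_X, laurentExpansion, RatFunc.liftRingHom_algebraMap]
  simp [add_comm]

/-- The universal binomial series `(1 + a X) ^ m`. -/
lemma exists_binomialSeries (a : k) (m : ℤ) : ∃ p : PowerSeries k,
    PowerSeries.coeff 0 p = 1 ∧
    (∀ j : ℕ, 0 ≤ m → m < j → PowerSeries.coeff j p = 0) ∧
    ∀ {S : Type*} [Field S] (f : PowerSeries k →+* S),
      f p = f (1 + PowerSeries.C a * PowerSeries.X) ^ m := by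
  obtain ⟨l, rfl | rfl⟩ := m.eq_nat_or_neg
  · refine ⟨(1 + PowerSeries.C a * PowerSeries.X) ^ l, by simp, fun j _ hj => ?_, by simp⟩
    have h : ((1 + Polynomial.C a * Polynomial.X : Polynomial k) ^ l : Polynomial k)
        = ((1 + PowerSeries.C a * PowerSeries.X) ^ l : PowerSeries k) := by simp
    rw [← h, Polynomial.coeff_coe]
    apply Polynomial.coeff_eq_zero_of_natDegree_lt
    refine lt_of_le_of_lt (b := l) ?_ (by exact_mod_cast hj)
    refine Polynomial.natDegree_pow_le_of_le (m := 1) l ?_ |>.trans (by simp)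
    compute_degree
  · refine ⟨((1 + PowerSeries.C a * PowerSeries.X) ^ l)⁻¹, ?_, fun j h hj => ?_, ?_⟩
    · simp
    · obtain rfl : l = 0 := by omega
      have : j ≠ 0 := by omega
      simp [PowerSeries.coeff_one, this]
    · intro S _ f
      have h : ((1 + PowerSeries.C a * PowerSeries.X) ^ l)⁻¹ *
          (1 + PowerSeries.C a * PowerSeries.X) ^ l = (1 : PowerSeries k) :=
        PowerSeries.inv_mul_cancel _ (by simp)
      rw [zpow_neg, zpow_natCast]
      exact eq_inv_of_mul_eq_one_left (by rw [← map_pow, ← map_mul, h, map_one])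

/-- An integer power of `y + a X`, `y ≠ 0`, is a power series, homogeneous in `y` and `X`. -/
lemma exists_powerSeries_zpow (a : k) (y : L) (hy : y ≠ 0) (m : ℤ) : ∃ g : PowerSeries L,
    HahnSeries.ofPowerSeries ℤ L g =
      (HahnSeries.C y + HahnSeries.single 1 (algebraMap k L a)) ^ m ∧
    PowerSeries.coeff 0 g = y ^ m ∧
    ∀ j : ℕ, ∃ c : k, PowerSeries.coeff j g = c • y ^ (m - j) ∧ (0 ≤ m → m < j → c = 0) := by
  obtain ⟨p, hp0, hp, hpf⟩ := exists_binomialSeries a m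
  let f : PowerSeries k →+* PowerSeries L :=
    (PowerSeries.rescale y⁻¹).comp (PowerSeries.map (algebraMap k L))
  have hcoeff (j : ℕ) : PowerSeries.coeff j (PowerSeries.C (y ^ m) * f p) =
      PowerSeries.coeff j p • y ^ (m - j) := by
    simp only [f, RingHom.comp_apply, PowerSeries.coeff_C_mul, PowerSeries.coeff_rescale,
      PowerSeries.coeff_map, Algebra.smul_def, zpow_sub₀ hy, zpow_natCast, inv_pow]
    ring
  refine ⟨PowerSeries.C (y ^ m) * f p, ?_, ?_, fun j => ⟨_, hcoeff j, hp j⟩⟩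
  · have := hpf ((HahnSeries.ofPowerSeries ℤ L).comp f)
    rw [RingHom.comp_apply] at this
    rw [map_mul, this, HahnSeries.ofPowerSeries_C, map_zpow₀, ← mul_zpow]
    congr 1
    have hC (a : L) : PowerSeries.rescale y⁻¹ (PowerSeries.C a) = PowerSeries.C a := by
      ext j
      rcases j with _ | j <;> simp [PowerSeries.coeff_rescale, PowerSeries.coeff_C]
    simp [f, PowerSeries.rescale_X, hC, mul_add, -HahnSeries.single_zero_mul_eq_smul,
      HahnSeries.C_apply, HahnSeries.single_mul_single]
    rw [mul_left_comm, mul_inv_cancel₀ hy, mul_one]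
  · rw [hcoeff, hp0]; simp

/-- The residue of a rational function at the point `β`. -/
def ratFuncResidue (β : L) : RatFunc L →+ L where
  toFun f := (laurentExpansion β f).coeff (-1)
  map_zero' := by simp
  map_add' := by simp

lemma ratFuncResidue_apply (β : L) (f : RatFunc L) :
    ratFuncResidue β f = (laurentExpansion β f).coeff (-1) := rfl

lemma ratFuncResidue_C_mul (β a : L) (f : RatFunc L) :
    ratFuncResidue β (RatFunc.C a * f) = a * ratFuncResidue β f := by
  simp [ratFuncResidue_apply, laurentExpansion_C, HahnSeries.C_apply]

lemma ratFuncResidue_smul (β : L) (c : k) (f : RatFunc L) :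
    ratFuncResidue β (c • f) = c • ratFuncResidue β f := by
  rw [← algebraMap_smul L c f, ← algebraMap_smul L c, RatFunc.smul_eq_C_mul,
    ratFuncResidue_C_mul, smul_eq_mul]

/-- The family of elements of `L(X)` extending `x` by the indeterminate. -/
def consX {n : ℕ} (x : Fin n → L) : Fin (n + 1) → RatFunc L :=
  Fin.cons RatFunc.X fun i => RatFunc.C (x i)

lemma linearCombination_consX {n : ℕ} (x : Fin n → L) (v : Fin (n + 1) → k) :
    Fintype.linearCombination k (consX x) v =
      v 0 • RatFunc.X + RatFunc.C (Fintype.linearCombination k x (Fin.tail v)) := by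
  have h (c : k) (a : L) : c • RatFunc.C a = RatFunc.C (c • a) := by
    rw [← algebraMap_smul L c, ← algebraMap_smul L c, RatFunc.smul_eq_C_mul, smul_eq_mul, map_mul]
  simp [Fintype.linearCombination_apply, Fin.sum_univ_succ, consX, h, Fin.tail]

/-- Restriction of linear forms to the hyperplane where the first coordinate equals the linear
form `w` of the others. -/
def restrictHyperplane {n : ℕ} (w : Fin n → k) : (Fin (n + 1) → k) →ₗ[k] (Fin n → k) where
  toFun v := Fin.tail v + v 0 • w
  map_add' u v := by ext; simp [Fin.tail]; ring
  map_smul' c v := by ext; simp [Fin.tail]; ring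

lemma restrictHyperplane_apply {n : ℕ} (w : Fin n → k) (v : Fin (n + 1) → k) :
    restrictHyperplane w v = Fin.tail v + v 0 • w := rfl

lemma restrictHyperplane_cons {n : ℕ} (w v : Fin n → k) (c : k) :
    restrictHyperplane w (Fin.cons c v) = v + c • w := by
  simp [restrictHyperplane_apply]

lemma laurentExpansion_linearCombination {n : ℕ} (x : Fin n → L) (w : Fin n → k)
    (v : Fin (n + 1) → k) :
    laurentExpansion (Fintype.linearCombination k x w)
        (Fintype.linearCombination k (consX x) v) =
      HahnSeries.C (Fintype.linearCombination k x (restrictHyperplane w v)) +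
        HahnSeries.single 1 (algebraMap k L (v 0)) := by
  rw [linearCombination_consX, ← algebraMap_smul L (v 0), RatFunc.smul_eq_C_mul,
    restrictHyperplane_apply]
  simp only [map_add, map_mul, map_smul, laurentExpansion_C, laurentExpansion_X, mul_add]
  rw [Algebra.smul_def, map_mul]
  rw [HahnSeries.C_apply (algebraMap k L (v 0)), HahnSeries.single_mul_single]
  simp only [zero_add, mul_one]
  ring

lemma linearIndependent_restrictHyperplane {n : ℕ} (w : Fin n → k)
    {b : Fin (n + 1) → Fin (n + 1) → k} (hb : LinearIndependent k b) {i : Fin (n + 1)}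
    (hi : restrictHyperplane w (b i) = 0) :
    LinearIndependent k fun j : Fin n => restrictHyperplane w (b (i.succAbove j)) := by
  apply linearIndependent_of_top_le_span_of_card_eq_finrank _ (by simp)
  have hsurj : Function.Surjective (restrictHyperplane w) := fun v =>
    ⟨Fin.cons 0 v, by simp [restrictHyperplane_cons]⟩
  have htop : Submodule.span k (Set.range b) = ⊤ := hb.span_eq_top_of_card_eq_finrank' (by simp)
  rw [← LinearMap.range_eq_top.2 hsurj, ← Submodule.map_top, ← htop, Submodule.map_span,
    Submodule.span_le]
  rintro _ ⟨_, ⟨l, rfl⟩, rfl⟩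
  by_cases h : l = i
  · subst h; rw [hi]; exact Submodule.zero_mem _
  · obtain ⟨j, rfl⟩ := Fin.exists_succAbove_eq h
    exact Submodule.subset_span ⟨j, rfl⟩

lemma single_zpow_eq (c : L) (m : ℤ) :
    (HahnSeries.single 1 c : LaurentSeries L) ^ m = HahnSeries.single m (c ^ m) := by
  have : (HahnSeries.single 1 c : LaurentSeries L) = HahnSeries.C c * HahnSeries.single 1 1 := by
    simp [HahnSeries.C_apply]
  rw [this, mul_zpow, ← map_zpow₀, ← RatFunc.single_zpow, HahnSeries.C_apply,
    HahnSeries.single_mul_single]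
  simp

/-- Off the polar hyperplanes of a Laurent monomial, its residue vanishes. -/
lemma ratFuncResidue_laurentMonomial_of_ne {n : ℕ} (x : Fin n → L)
    (hx : LinearIndependent k x) (w : Fin n → k) (b : Fin (n + 1) → Fin (n + 1) → k)
    (m : Fin (n + 1) → ℤ) (h : ∀ i, restrictHyperplane w (b i) ≠ 0) :
    ratFuncResidue (Fintype.linearCombination k x w) (laurentMonomial k (consX x) b m) = 0 := by
  have hinj := linearIndependent_iff_injective_fintypeLinearCombination.1 hx
  choose g hg _ _ using fun i => exists_powerSeries_zpow (b i 0)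
    (Fintype.linearCombination k x (restrictHyperplane w (b i)))
    ((map_ne_zero_iff _ hinj).2 (h i)) (m i)
  have : laurentExpansion (Fintype.linearCombination k x w) (laurentMonomial k (consX x) b m) =
      HahnSeries.ofPowerSeries ℤ L (∏ i, g i) := by
    simp only [laurentMonomial, map_prod, map_zpow₀, laurentExpansion_linearCombination, hg]
  rw [ratFuncResidue_apply, this, PowerSeries.coeff_coe, if_pos (by norm_num)]

/-- The residue of a Laurent monomial along one of its factors. -/
lemma ratFuncResidue_laurentMonomial_of_eq {n : ℕ} (x : Fin n → L)
    (hx : LinearIndependent k x) (w : Fin n → k) {b : Fin (n + 1) → Fin (n + 1) → k}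
    (hb : LinearIndependent k b) (m : Fin (n + 1) → ℤ) {i : Fin (n + 1)}
    (hi : restrictHyperplane w (b i) = 0) :
    ((m = fun _ => -1) →
      ratFuncResidue (Fintype.linearCombination k x w) (laurentMonomial k (consX x) b m) ∈
        simpleFractionSpan k x) ∧
    ((m ≠ fun _ => -1) →
      ratFuncResidue (Fintype.linearCombination k x w) (laurentMonomial k (consX x) b m) ∈
        nonsimpleMonomialSpan k x) := by
  have hinj := linearIndependent_iff_injective_fintypeLinearCombination.1 hx
  have hli := linearIndependent_restrictHyperplane w hb hi
  set b' : Fin n → Fin n → k := fun j => restrictHyperplane w (b (i.succAbove j)) with hb'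
  have hne (j) : Fintype.linearCombination k x (b' j) ≠ 0 :=
    (map_ne_zero_iff _ hinj).2 (hli.ne_zero j)
  choose g hg hg0 c hc hc0 using fun j => exists_powerSeries_zpow (b (i.succAbove j) 0)
    (Fintype.linearCombination k x (b' j)) (hne j) (m (i.succAbove j))
  have hexp : laurentExpansion (Fintype.linearCombination k x w)
      (laurentMonomial k (consX x) b m) =
      HahnSeries.single (m i) (algebraMap k L (b i 0 ^ m i)) *
        HahnSeries.ofPowerSeries ℤ L (∏ j, g j) := by
    rw [laurentMonomial, Fin.prod_univ_succAbove _ i]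
    simp only [map_mul, map_prod, map_zpow₀, laurentExpansion_linearCombination, hg, hi, map_zero,
      zero_add, single_zpow_eq, hb']
  have hres : ratFuncResidue (Fintype.linearCombination k x w)
      (laurentMonomial k (consX x) b m) =
      (b i 0 ^ m i) • (HahnSeries.ofPowerSeries ℤ L (∏ j, g j)).coeff (-1 - m i) := by
    rw [ratFuncResidue_apply, hexp, HahnSeries.coeff_single_mul, Algebra.smul_def]
  rw [hres]
  constructor
  · rintro rfl
    refine Submodule.smul_mem _ _ (Submodule.subset_span ⟨b', hli, ?_⟩)
    simp only [PowerSeries.coeff_zero_eq_constantCoeff_apply] at hg0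
    rw [PowerSeries.coeff_coe, if_neg (by norm_num), sub_self, Int.natAbs_zero,
      PowerSeries.coeff_zero_eq_constantCoeff_apply, map_prod, laurentMonomial]
    exact prod_congr rfl fun j _ => hg0 j
  · intro hm
    apply Submodule.smul_mem
    rw [PowerSeries.coeff_coe]
    split_ifs with hneg
    · exact Submodule.zero_mem _
    rw [PowerSeries.coeff_prod]
    refine Submodule.sum_mem _ fun l hl => ?_
    have hprod : ∏ j, PowerSeries.coeff (l j) (g j) = (∏ j, c j (l j)) •
        laurentMonomial k x b' fun j => m (i.succAbove j) - l j := by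
      simp only [hc, laurentMonomial, Algebra.smul_def, prod_mul_distrib, map_prod]
    rw [hprod]
    by_cases hall : (fun j => m (i.succAbove j) - l j) = fun _ => (-1 : ℤ)
    · have hall' (j) : m (i.succAbove j) - l j = -1 := congrFun hall j
      obtain ⟨j, hj⟩ : ∃ j, l j ≠ 0 := by
        by_contra! h0
        apply hm
        have hsum := (mem_finsuppAntidiag.1 hl).1
        simp only [h0, sum_const_zero] at hsum
        ext t
        by_cases ht : t = i
        · subst ht; omega
        · obtain ⟨j, rfl⟩ := Fin.exists_succAbove_eq ht
          have := hall' j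
          rw [h0 j] at this
          simpa using this
      have := hall' j
      have : ∏ j, c j (l j) = 0 :=
        prod_eq_zero (mem_univ j) (hc0 j (l j) (by omega) (by omega))
      rw [this, zero_smul]
      exact Submodule.zero_mem _
    · exact Submodule.smul_mem _ _ (Submodule.subset_span ⟨b', _, hli, hall, rfl⟩)

lemma ratFuncResidue_inv_X_sub_C [DecidableEq L] (β γ : L) :
    ratFuncResidue β (RatFunc.X - RatFunc.C γ)⁻¹ = if γ = β then 1 else 0 := by
  rw [ratFuncResidue_apply, map_inv₀, map_sub, laurentExpansion_X, laurentExpansion_C]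
  split_ifs with h
  · rw [h, add_sub_cancel_left, ← zpow_neg_one, single_zpow_eq]
    simp
  · obtain ⟨g, hg, -⟩ := exists_powerSeries_zpow (1 : L) (β - γ) (sub_ne_zero.2 (Ne.symm h)) (-1)
    have : (HahnSeries.C β + HahnSeries.single 1 1 - HahnSeries.C γ : LaurentSeries L)⁻¹ =
        HahnSeries.ofPowerSeries ℤ L g := by
      rw [hg, zpow_neg_one, map_sub, (algebraMap L L).map_one]
      congr 1
      ring
    rw [this, PowerSeries.coeff_coe, if_pos (by norm_num)]

/-- A rational function which is a combination of simple poles is determined by its residues. -/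
lemma eq_zero_of_residues_eq_zero {ι : Type*} {β : ι → L} (hβ : Function.Injective β)
    {f : RatFunc L}
    (hf : f ∈ Submodule.span L (Set.range fun i => (RatFunc.X - RatFunc.C (β i))⁻¹))
    (h : ∀ i, ratFuncResidue (β i) f = 0) : f = 0 := by
  classical
  obtain ⟨c, rfl⟩ := Finsupp.mem_span_range_iff_exists_finsupp.1 hf
  suffices hc : c = 0 by simp [hc]
  ext i
  have := h i
  simp only [Finsupp.sum, map_sum, RatFunc.smul_eq_C_mul, ratFuncResidue_C_mul,
    ratFuncResidue_inv_X_sub_C, hβ.eq_iff] at this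
  simpa using this

lemma X_sub_C_ne_zero (β : L) : (RatFunc.X - RatFunc.C β : RatFunc L) ≠ 0 := by
  rw [← RatFunc.algebraMap_X, ← RatFunc.algebraMap_C, ← map_sub]
  exact RatFunc.algebraMap_ne_zero (Polynomial.X_sub_C_ne_zero β)

/-- Partial fractions with simple poles. -/
lemma prod_inv_X_sub_C_mem_span {ι : Type*} {β : ι → L} {s : Finset ι} (hβ : Set.InjOn β s)
    (hs : s.Nonempty) :
    ∏ i ∈ s, (RatFunc.X - RatFunc.C (β i))⁻¹ ∈
      Submodule.span L ((fun i => (RatFunc.X - RatFunc.C (β i))⁻¹) '' (s : Set ι)) := by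
  classical
  induction hs using Finset.Nonempty.cons_induction with
  | singleton i => exact Submodule.subset_span (by simp)
  | cons i s hi hs ih =>
    rw [prod_cons]
    have hβ' : Set.InjOn β s := hβ.mono (by simp)
    have := ih hβ'
    generalize ∏ i ∈ s, (RatFunc.X - RatFunc.C (β i))⁻¹ = f at this
    induction this using Submodule.span_induction with
    | zero => simp
    | add f g _ _ hf hg => rw [mul_add]; exact Submodule.add_mem _ hf hg
    | smul c f _ hf => rw [mul_smul_comm]; exact Submodule.smul_mem _ _ hf
    | mem f hf =>
      obtain ⟨j, hj, rfl⟩ := hf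
      have hne : β i ≠ β j := fun h => hi (by
        rwa [hβ (by simp) (by simpa using Or.inr hj) h])
      have hC : RatFunc.C (β i) - RatFunc.C (β j) ≠ (0 : RatFunc L) := by
        rw [← map_sub]
        exact (map_ne_zero _).2 (sub_ne_zero.2 hne)
      have key : (RatFunc.X - RatFunc.C (β i))⁻¹ * (RatFunc.X - RatFunc.C (β j))⁻¹ =
          (β i - β j)⁻¹ • (RatFunc.X - RatFunc.C (β i))⁻¹ -
            (β i - β j)⁻¹ • (RatFunc.X - RatFunc.C (β j))⁻¹ := by
        have hi := X_sub_C_ne_zero (β i)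
        have hj := X_sub_C_ne_zero (β j)
        simp only [RatFunc.smul_eq_C_mul, map_inv₀, map_sub]
        field_simp
        ring
      simp only [key]
      exact Submodule.sub_mem _
        (Submodule.smul_mem _ _ (Submodule.subset_span ⟨i, by simp, rfl⟩))
        (Submodule.smul_mem _ _ (Submodule.subset_span ⟨j, by simpa using Or.inr hj, rfl⟩))

/-- A simple fraction has only simple poles in the first variable and vanishes at infinity. -/
lemma laurentMonomial_consX_mem_span {n : ℕ} {x : Fin n → L} (hx : LinearIndependent k x)
    {b : Fin (n + 1) → Fin (n + 1) → k} (hb : LinearIndependent k b) :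
    laurentMonomial k (consX x) b (fun _ => -1) ∈ Submodule.span L (Set.range
      fun w : Fin n → k => (RatFunc.X - RatFunc.C (Fintype.linearCombination k x w))⁻¹) := by
  classical
  have hinj := linearIndependent_iff_injective_fintypeLinearCombination.1 hx
  let J : Finset (Fin (n + 1)) := univ.filter fun i => b i 0 ≠ 0
  let w : Fin (n + 1) → Fin n → k := fun i => -(b i 0)⁻¹ • Fin.tail (b i)
  have hJ : J.Nonempty := by
    by_contra hJ
    have h0 (i) : b i 0 = 0 := by
      by_contra h
      exact hJ ⟨i, by simpa [J] using h⟩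
    have htop : Submodule.span k (Set.range b) = ⊤ := hb.span_eq_top_of_card_eq_finrank' (by simp)
    have : Submodule.span k (Set.range b) ≤ LinearMap.ker (LinearMap.proj 0) := by
      rw [Submodule.span_le]
      rintro _ ⟨i, rfl⟩
      simpa using h0 i
    rw [htop] at this
    have := this (Submodule.mem_top (x := Pi.single 0 1))
    simp at this
  have hres (i) (hi : b i 0 ≠ 0) : restrictHyperplane (w i) (b i) = 0 := by
    simp [restrictHyperplane_apply, w, smul_smul, hi]
  have hw : Set.InjOn (fun i => Fintype.linearCombination k x (w i)) J := by
    intro i hi j hj hij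
    have hi : b i 0 ≠ 0 := by simpa [J] using hi
    have hj : b j 0 ≠ 0 := by simpa [J] using hj
    have hij : w i = w j := hinj hij
    by_contra hne
    obtain ⟨l, rfl⟩ := Fin.exists_succAbove_eq (Ne.symm hne)
    exact (linearIndependent_restrictHyperplane (w i) hb (hres i hi)).ne_zero l
      (by rw [hij]; exact hres _ hj)
  have hsplit : laurentMonomial k (consX x) b (fun _ => -1) =
      RatFunc.C ((∏ i ∈ J, algebraMap k L (b i 0)⁻¹) *
        ∏ i ∈ Jᶜ, (Fintype.linearCombination k x (Fin.tail (b i)))⁻¹) *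
      ∏ i ∈ J, (RatFunc.X - RatFunc.C (Fintype.linearCombination k x (w i)))⁻¹ := by
    rw [laurentMonomial, ← prod_mul_prod_compl J, map_mul, map_prod, map_prod, mul_right_comm,
      ← prod_mul_distrib]
    congr 1
    · refine prod_congr rfl fun i hi => ?_
      have hi : b i 0 ≠ 0 := by simpa [J] using hi
      rw [linearCombination_consX, zpow_neg_one, map_inv₀, map_inv₀, ← mul_inv]
      congr 1
      have hw : Fintype.linearCombination k x (w i) =
          -((algebraMap k L (b i 0))⁻¹ * Fintype.linearCombination k x (Fin.tail (b i))) := by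
        rw [map_smul, neg_smul, Algebra.smul_def, map_inv₀]
      rw [hw, ← algebraMap_smul L (b i 0), RatFunc.smul_eq_C_mul, map_neg, sub_neg_eq_add,
        mul_add, ← map_mul, mul_inv_cancel_left₀ (by simpa using hi)]
    · refine prod_congr rfl fun i hi => ?_
      have hi : b i 0 = 0 := by simpa [J] using hi
      rw [linearCombination_consX, zpow_neg_one, hi, zero_smul, zero_add, map_inv₀]
  rw [hsplit, ← RatFunc.smul_eq_C_mul]
  refine Submodule.smul_mem _ _ (Submodule.span_mono ?_ (prod_inv_X_sub_C_mem_span hw hJ))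
  rintro _ ⟨i, -, rfl⟩
  exact ⟨w i, rfl⟩

lemma algebraicIndependent_consX {n : ℕ} {x : Fin n → L} (hx : AlgebraicIndependent k x) :
    AlgebraicIndependent k (consX x) := by
  have hcomp : aeval (consX x) = (IsScalarTower.toAlgHom k (Polynomial L) (RatFunc L)).comp
      ((Polynomial.mapAlgHom (aeval x)).comp (finSuccEquiv k n).toAlgHom) := by
    ext i
    refine Fin.cases ?_ (fun i => ?_) i <;> simp [consX, finSuccEquiv_X_zero, finSuccEquiv_X_succ]
  rw [algebraicIndependent_iff_injective_aeval, hcomp]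
  exact (RatFunc.algebraMap_injective L).comp
    ((Polynomial.map_injective (aeval x).toRingHom hx).comp (finSuccEquiv k n).injective)

lemma disjoint_consX {n : ℕ} {x : Fin n → L} (hx : LinearIndependent k x)
    (h : Disjoint (simpleFractionSpan k x) (nonsimpleMonomialSpan k x)) :
    Disjoint (simpleFractionSpan k (consX x)) (nonsimpleMonomialSpan k (consX x)) := by
  rw [Submodule.disjoint_def] at h ⊢
  intro s hs ht
  have hinj := linearIndependent_iff_injective_fintypeLinearCombination.1 hx
  refine eq_zero_of_residues_eq_zero hinj ?_ fun w => h _ ?_ ?_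
  · suffices hle : simpleFractionSpan k (consX x) ≤ (Submodule.span L (Set.range
        fun w : Fin n → k => (RatFunc.X - RatFunc.C
          (Fintype.linearCombination k x w))⁻¹)).restrictScalars k from hle hs
    refine Submodule.span_le.2 ?_
    rintro _ ⟨b, hb, rfl⟩
    exact laurentMonomial_consX_mem_span hx hb
  · clear ht
    induction hs using Submodule.span_induction with
    | zero => simp
    | add f g _ _ hf hg => rw [map_add]; exact Submodule.add_mem _ hf hg
    | smul c f _ hf => rw [ratFuncResidue_smul]; exact Submodule.smul_mem _ _ hf
    | mem f hf =>
      obtain ⟨b, hb, rfl⟩ := hf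
      by_cases hi : ∃ i, restrictHyperplane w (b i) = 0
      · obtain ⟨i, hi⟩ := hi
        exact (ratFuncResidue_laurentMonomial_of_eq x hx w hb _ hi).1 rfl
      · push Not at hi
        rw [ratFuncResidue_laurentMonomial_of_ne x hx w b _ hi]
        exact Submodule.zero_mem _
  · clear hs
    induction ht using Submodule.span_induction with
    | zero => simp
    | add f g _ _ hf hg => rw [map_add]; exact Submodule.add_mem _ hf hg
    | smul c f _ hf => rw [ratFuncResidue_smul]; exact Submodule.smul_mem _ _ hf
    | mem f hf =>
      obtain ⟨b, m, hb, hm, rfl⟩ := hf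
      by_cases hi : ∃ i, restrictHyperplane w (b i) = 0
      · obtain ⟨i, hi⟩ := hi
        exact (ratFuncResidue_laurentMonomial_of_eq x hx w hb _ hi).2 hm
      · push Not at hi
        rw [ratFuncResidue_laurentMonomial_of_ne x hx w b _ hi]
        exact Submodule.zero_mem _

universe u in
/-- There are algebraically independent elements for which simple fractions and non-simple Laurent
monomials are linearly disjoint. -/
lemma exists_algebraicIndependent_disjoint (k : Type u) [Field k] (n : ℕ) :
    ∃ (L : Type u) (_ : Field L) (_ : Algebra k L) (x : Fin n → L), AlgebraicIndependent k x ∧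
      Disjoint (simpleFractionSpan k x) (nonsimpleMonomialSpan k x) := by
  induction n with
  | zero =>
    refine ⟨k, inferInstance, inferInstance, Fin.elim0, algebraicIndependent_empty_type, ?_⟩
    have : nonsimpleMonomialSpan k (Fin.elim0 : Fin 0 → k) = ⊥ := by
      rw [nonsimpleMonomialSpan, Submodule.span_eq_bot]
      rintro _ ⟨b, m, -, hm, -⟩
      exact absurd (Subsingleton.elim _ _) hm
    rw [this]
    exact disjoint_bot_right
  | succ n ih =>
    obtain ⟨L, _, _, x, hx, h⟩ := ih
    exact ⟨RatFunc L, inferInstance, inferInstance, consX x, algebraicIndependent_consX hx,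
      disjoint_consX hx.linearIndependent h⟩

/-- The coordinate functions in the field of rational functions. -/
def fracCoordinate (k L : Type*) [Field k] [Field L] (n : ℕ)
    [Algebra (MvPolynomial (Fin n) k) L] (i : Fin n) : L :=
  algebraMap (MvPolynomial (Fin n) k) L (X i)

/-- Simple fractions and non-simple Laurent monomials are linearly disjoint in the field of
rational functions. -/
lemma disjoint_simpleFractionSpan {n : ℕ} [Algebra (MvPolynomial (Fin n) k) L]
    [IsScalarTower k (MvPolynomial (Fin n) k) L] [IsFractionRing (MvPolynomial (Fin n) k) L] :
    Disjoint (simpleFractionSpan k (fracCoordinate k L n))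
      (nonsimpleMonomialSpan k (fracCoordinate k L n)) := by
  obtain ⟨E, _, _, x, hx, h⟩ := exists_algebraicIndependent_disjoint k n
  have hinj : Function.Injective (aeval x : MvPolynomial (Fin n) k →ₐ[k] E) := hx
  let φ : L →ₐ[k] E := IsFractionRing.liftAlgHom hinj
  have hφ (i) : φ (fracCoordinate k L n i) = x i :=
    (IsFractionRing.lift_algebraMap hinj (X i)).trans (aeval_X _ _)
  have hmon (b : Fin n → Fin n → k) (m : Fin n → ℤ) :
      φ (laurentMonomial k (fracCoordinate k L n) b m) =
        laurentMonomial k x b m := by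
    simp only [laurentMonomial, map_prod, map_zpow₀, Fintype.linearCombination_apply, map_sum,
      map_smul, hφ]
  rw [Submodule.disjoint_def] at h ⊢
  intro s hs ht
  refine (map_eq_zero φ).1 (h _ ?_ ?_)
  · suffices hle : simpleFractionSpan k _ ≤ (simpleFractionSpan k x).comap φ.toLinearMap from
      hle hs
    refine Submodule.span_le.2 ?_
    rintro _ ⟨b, hb, rfl⟩
    exact Submodule.subset_span ⟨b, hb, hmon _ _⟩
  · suffices hle : nonsimpleMonomialSpan k _ ≤ (nonsimpleMonomialSpan k x).comap φ.toLinearMap from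
      hle ht
    refine Submodule.span_le.2 ?_
    rintro _ ⟨b, m, hb, hm, rfl⟩
    exact Submodule.subset_span ⟨b, m, hb, hm, hmon _ _⟩

end CombinatorialCore

section LaurentSpan

open Finset

variable {k : Type*} [Field k] {n : ℕ}

lemma mem_range_linearCombination_X {ψ : MvPolynomial (Fin n) k} :
    ψ ∈ LinearMap.range (Fintype.linearCombination k (X : Fin n → MvPolynomial (Fin n) k)) ↔
      ψ.IsHomogeneous 1 := by
  rw [Fintype.range_linearCombination, ← homogeneousSubmodule_one_eq_span_X,
    mem_homogeneousSubmodule]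

lemma linearCombination_X_injective :
    Function.Injective (Fintype.linearCombination k (X : Fin n → MvPolynomial (Fin n) k)) :=
  linearIndependent_iff_injective_fintypeLinearCombination.1
    (algebraicIndependent_X (Fin n) k).linearIndependent

lemma span_preimage_linearCombination_X {s : Set (MvPolynomial (Fin n) k)}
    (hhom : ∀ φ ∈ s, φ.IsHomogeneous 1)
    (hspan : ∀ ψ : MvPolynomial (Fin n) k, ψ.IsHomogeneous 1 → ψ ∈ Submodule.span k s) :
    Submodule.span k (Fintype.linearCombination k X ⁻¹' s) = ⊤ := by
  rw [eq_top_iff]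
  intro v _
  have hv := hspan _ (mem_range_linearCombination_X.1 ⟨v, rfl⟩)
  have hs : s ⊆ Set.range (Fintype.linearCombination k (X : Fin n → MvPolynomial (Fin n) k)) :=
    fun φ hφ => mem_range_linearCombination_X.2 (hhom φ hφ)
  rw [← Set.image_preimage_eq_of_subset hs, ← Submodule.map_span] at hv
  obtain ⟨u, hu, huv⟩ := hv
  rwa [← linearCombination_X_injective huv]

lemma linearIndependent_preimage_linearCombination_X {s : Set (MvPolynomial (Fin n) k)}
    (hs : LinearIndependent k ((↑) : s → MvPolynomial (Fin n) k)) :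
    LinearIndependent k
      ((↑) : (Fintype.linearCombination k X ⁻¹' s : Set (Fin n → k)) → Fin n → k) := by
  let g : (Fintype.linearCombination k X ⁻¹' s : Set (Fin n → k)) → s :=
    fun v => ⟨Fintype.linearCombination k X v.1, v.2⟩
  have hg : Function.Injective g := fun v w h =>
    Subtype.ext (linearCombination_X_injective (congrArg Subtype.val h))
  exact LinearIndependent.of_comp (Fintype.linearCombination k X) (hs.comp g hg)

lemma exists_basis_range_eq {s : Set (Fin n → k)} (hli : LinearIndependent k ((↑) : s → Fin n → k))
    (hspan : Submodule.span k s = ⊤) :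
    ∃ b : Fin n → Fin n → k, LinearIndependent k b ∧ Set.range b = s := by
  let B : Module.Basis s k (Fin n → k) := Module.Basis.mk hli (by simp [hspan])
  let e : Fin n ≃ s := (Pi.basisFun k (Fin n)).indexEquiv B
  refine ⟨fun i => e i, hli.comp e e.injective, ?_⟩
  rw [← Function.comp_def, e.surjective.range_comp, Subtype.range_coe]

variable {L : Type*} [Field L] [Algebra (MvPolynomial (Fin n) k) L] [Algebra k L]

lemma laurentMonomial_mul_zpow {b : Fin n → Fin n → k} {i : Fin n}
    (hi : Fintype.linearCombination k (fracCoordinate k L n) (b i) ≠ 0) (m : Fin n → ℤ) (q : ℤ) :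
    laurentMonomial k (fracCoordinate k L n) b m *
        Fintype.linearCombination k (fracCoordinate k L n) (b i) ^ q =
      laurentMonomial k (fracCoordinate k L n) b (m + Pi.single i q) := by
  obtain ⟨e, he⟩ : ∃ e, e = m + Pi.single i q := ⟨_, rfl⟩
  rw [← he, laurentMonomial, laurentMonomial, ← mul_prod_erase univ _ (mem_univ i),
    ← mul_prod_erase univ (fun j => _ ^ e j) (mem_univ i), mul_right_comm, ← zpow_add₀ hi, he]
  congr 1
  · simp
  · exact prod_congr rfl fun j hj => by simp [ne_of_mem_erase hj]

variable [IsScalarTower k (MvPolynomial (Fin n) k) L]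

lemma algebraMap_linearCombination_X (v : Fin n → k) :
    algebraMap (MvPolynomial (Fin n) k) L (Fintype.linearCombination k X v) =
      Fintype.linearCombination k (fracCoordinate k L n) v := by
  simp only [Fintype.linearCombination_apply, map_sum, fracCoordinate, Algebra.smul_def, map_mul,
    ← IsScalarTower.algebraMap_apply]

lemma linearCombination_fracCoordinate_ne_zero [IsFractionRing (MvPolynomial (Fin n) k) L]
    {v : Fin n → k} (hv : v ≠ 0) : Fintype.linearCombination k (fracCoordinate k L n) v ≠ 0 := by
  rw [← algebraMap_linearCombination_X]
  refine (map_ne_zero_iff _ (IsFractionRing.injective _ L)).2 ?_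
  exact (map_ne_zero_iff _ linearCombination_X_injective).2 hv

/-- A tuple of vectors is a basis drawn from `Δ` if it is a basis and the corresponding linear forms
belong to `Δ`. -/
def IsBasisIn (Δ : Set (MvPolynomial (Fin n) k)) (b : Fin n → Fin n → k) : Prop :=
  LinearIndependent k b ∧ ∀ i, Fintype.linearCombination k X (b i) ∈ Δ

variable (L) in
/-- The span of the Laurent monomials in bases drawn from `Δ`. -/
def laurentSpan (Δ : Set (MvPolynomial (Fin n) k)) : Submodule k L :=
  Submodule.span k {f | ∃ (b : Fin n → Fin n → k) (m : Fin n → ℤ), IsBasisIn Δ b ∧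
    f = laurentMonomial k (fracCoordinate k L n) b m}

variable [IsFractionRing (MvPolynomial (Fin n) k) L]

lemma exists_eq_sum_of_linearIndependent {b : Fin n → Fin n → k} (hb : LinearIndependent k b)
    (v : Fin n → k) : ∃ c : Fin n → k, v = ∑ i, c i • b i := by
  have h : v ∈ Submodule.span k (Set.range b) := by
    rw [hb.span_eq_top_of_card_eq_finrank' (by simp)]
    trivial
  obtain ⟨c, hc⟩ := (Submodule.mem_span_range_iff_exists_fun k).1 h
  exact ⟨c, hc.symm⟩

lemma algebraMap_mul_mem_laurentSpan {Δ : Set (MvPolynomial (Fin n) k)}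
    (P : MvPolynomial (Fin n) k) {f : L} (hf : f ∈ laurentSpan L Δ) :
    algebraMap (MvPolynomial (Fin n) k) L P * f ∈ laurentSpan L Δ := by
  induction P using MvPolynomial.induction_on generalizing f with
  | C a =>
    have : algebraMap (MvPolynomial (Fin n) k) L (C a) * f = a • f := by
      rw [← algebraMap_eq, ← IsScalarTower.algebraMap_apply, Algebra.smul_def]
    rw [this]
    exact Submodule.smul_mem _ _ hf
  | add P Q hP hQ =>
    rw [map_add, add_mul]
    exact Submodule.add_mem _ (hP hf) (hQ hf)
  | mul_X P j hP =>
    rw [map_mul, mul_assoc]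
    refine hP ?_
    induction hf using Submodule.span_induction with
    | zero => simp
    | add f g _ _ hf hg => rw [mul_add]; exact Submodule.add_mem _ hf hg
    | smul c f _ hf => rw [mul_smul_comm]; exact Submodule.smul_mem _ _ hf
    | mem f hf =>
      obtain ⟨b, m, hb, rfl⟩ := hf
      obtain ⟨c, hc⟩ := exists_eq_sum_of_linearIndependent hb.1 (Pi.single j 1)
      have hX : algebraMap (MvPolynomial (Fin n) k) L (X j) =
          ∑ i, c i • Fintype.linearCombination k (fracCoordinate k L n) (b i) := by
        simp only [← map_smul, ← map_sum, ← hc, Fintype.linearCombination_apply_single, one_smul,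
          fracCoordinate]
      rw [hX, sum_mul]
      refine Submodule.sum_mem _ fun i _ => ?_
      rw [smul_mul_assoc, mul_comm, ← zpow_one (Fintype.linearCombination k _ (b i)),
        laurentMonomial_mul_zpow (linearCombination_fracCoordinate_ne_zero (hb.1.ne_zero i))]
      exact Submodule.smul_mem _ _ (Submodule.subset_span ⟨b, _, hb, rfl⟩)

/-- Exchange: dividing a Laurent monomial by powers of another linear form of `Δ` stays within the
span of the Laurent monomials. -/
lemma laurentMonomial_mul_zpow_mem_laurentSpan {Δ : Set (MvPolynomial (Fin n) k)}
    {b : Fin n → Fin n → k} (hb : IsBasisIn Δ b) {u : Fin n → k} (hu : u ≠ 0)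
    (huΔ : Fintype.linearCombination k X u ∈ Δ) (m : Fin n → ℤ) (q : ℤ) :
    laurentMonomial k (fracCoordinate k L n) b m *
      Fintype.linearCombination k (fracCoordinate k L n) u ^ q ∈ laurentSpan L Δ := by
  classical
  obtain ⟨c, hc⟩ := exists_eq_sum_of_linearIndependent hb.1 u
  obtain ⟨N, hN⟩ : ∃ N : ℕ, ∑ i ∈ univ.filter (fun i => c i ≠ 0), (-m i).toNat = N := ⟨_, rfl⟩
  have hu' := linearCombination_fracCoordinate_ne_zero (L := L) hu
  induction N using Nat.strong_induction_on generalizing m q with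
  | _ N ih =>
  by_cases h : ∃ i, c i ≠ 0 ∧ 0 ≤ m i
  · obtain ⟨i, hci, hmi⟩ := h
    have hli : LinearIndependent k (Function.update b i u) := by
      refine hb.1.update i u ⟨1, one_mem _, Finsupp.equivFunOnFinite.symm c, by simpa using hci, ?_⟩
      rw [one_smul, Finsupp.linearCombination_apply, Finsupp.sum_fintype _ _ (by simp)]
      exact hc
    have key : laurentMonomial k (fracCoordinate k L n) b m *
        Fintype.linearCombination k (fracCoordinate k L n) u ^ q =
        algebraMap (MvPolynomial (Fin n) k) L
          (Fintype.linearCombination k X (b i) ^ (m i).toNat) *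
        laurentMonomial k (fracCoordinate k L n) (Function.update b i u)
          (Function.update m i q) := by
      rw [map_pow, algebraMap_linearCombination_X, ← zpow_natCast, Int.toNat_of_nonneg hmi,
        laurentMonomial, laurentMonomial, ← mul_prod_erase univ _ (mem_univ i),
        ← mul_prod_erase univ (fun j => _ ^ Function.update m i q j) (mem_univ i),
        mul_right_comm, mul_assoc]
      simp only [Function.update_self]
      congr 2
      exact prod_congr rfl fun j hj => by simp [Function.update_of_ne (ne_of_mem_erase hj)]
    rw [key]
    refine algebraMap_mul_mem_laurentSpan _ (Submodule.subset_span ⟨_, _, ⟨hli, fun j => ?_⟩, rfl⟩)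
    by_cases hj : j = i
    · subst hj; simpa using huΔ
    · simpa [Function.update_of_ne hj] using hb.2 j
  · push Not at h
    have key : laurentMonomial k (fracCoordinate k L n) b m *
        Fintype.linearCombination k (fracCoordinate k L n) u ^ q =
        ∑ i, c i • (laurentMonomial k (fracCoordinate k L n) b (m + Pi.single i 1) *
          Fintype.linearCombination k (fracCoordinate k L n) u ^ (q - 1)) := by
      have hsum : Fintype.linearCombination k (fracCoordinate k L n) u =
          ∑ i, c i • Fintype.linearCombination k (fracCoordinate k L n) (b i) := by
        simp only [← map_smul, ← map_sum, ← hc]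
      have hq : Fintype.linearCombination k (fracCoordinate k L n) u ^ q =
          Fintype.linearCombination k (fracCoordinate k L n) u *
          Fintype.linearCombination k (fracCoordinate k L n) u ^ (q - 1) := by
        rw [← zpow_one_add₀ hu']
        congr 1
        ring
      rw [hq]
      nth_rw 1 [hsum]
      rw [sum_mul, mul_sum]
      refine sum_congr rfl fun i _ => ?_
      rw [← laurentMonomial_mul_zpow
        (linearCombination_fracCoordinate_ne_zero (hb.1.ne_zero i)), zpow_one, smul_mul_assoc,
        mul_smul_comm, mul_assoc]
    rw [key]
    refine Submodule.sum_mem _ fun i _ => ?_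
    by_cases hci : c i = 0
    · rw [hci, zero_smul]; exact Submodule.zero_mem _
    refine Submodule.smul_mem _ _ (ih _ ?_ _ _ rfl)
    rw [← hN]
    refine sum_lt_sum (fun j _ => ?_) ⟨i, by simpa using hci, ?_⟩
    · by_cases hj : j = i
      · subst hj; simp
      · simp [hj]
    · have := h i hci
      simp; omega

end LaurentSpan

section Comparison

open Finset

variable {k : Type*} [Field k] {n : ℕ} {L : Type*} [Field L]
  [Algebra (MvPolynomial (Fin n) k) L] [Algebra k L]
  [IsScalarTower k (MvPolynomial (Fin n) k) L]

lemma Sdelta_eq_span {Δ : Finset (MvPolynomial (Fin n) k)} (hhom : ∀ φ ∈ Δ, φ.IsHomogeneous 1) :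
    Sdelta k L Δ = Submodule.span k {f | ∃ b, IsBasisIn (Δ : Set (MvPolynomial (Fin n) k)) b ∧
      f = laurentMonomial k (fracCoordinate k L n) b fun _ => -1} := by
  classical
  have hmon (b : Fin n → Fin n → k) (hb : LinearIndependent k b) :
      (∏ φ ∈ univ.image fun i => Fintype.linearCombination k X (b i),
        algebraMap (MvPolynomial (Fin n) k) L φ)⁻¹ =
      laurentMonomial k (fracCoordinate k L n) b fun _ => -1 := by
    rw [prod_image fun i _ j _ h => hb.injective (linearCombination_X_injective h), laurentMonomial,
      ← prod_inv_distrib]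
    simp only [algebraMap_linearCombination_X, zpow_neg_one]
  refine congrArg _ (Set.ext fun f => ⟨?_, ?_⟩)
  · rintro ⟨σ, hσΔ, ⟨hli, hsp⟩, rfl⟩
    obtain ⟨b, hb, hr⟩ := exists_basis_range_eq
      (linearIndependent_preimage_linearCombination_X hli)
      (span_preimage_linearCombination_X (fun φ hφ => hhom φ (hσΔ hφ)) hsp)
    have hσ : σ = univ.image fun i => Fintype.linearCombination k X (b i) := by
      apply Finset.coe_injective
      rw [coe_image, coe_univ, Set.image_univ, ← Function.comp_def, Set.range_comp, hr,
        Set.image_preimage_eq_of_subset]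
      exact fun φ hφ => mem_range_linearCombination_X.2 (hhom φ (hσΔ hφ))
    refine ⟨b, ⟨hb, fun i => hσΔ ?_⟩, by rw [← hmon b hb, ← hσ]⟩
    rw [hσ]
    simp
  · rintro ⟨b, hb, rfl⟩
    have hcoe : ((univ.image fun i => Fintype.linearCombination k X (b i) :
        Finset (MvPolynomial (Fin n) k)) : Set (MvPolynomial (Fin n) k)) =
        Set.range (Fintype.linearCombination k X ∘ b) := by
      simp [Function.comp_def]
    refine ⟨univ.image fun i => Fintype.linearCombination k X (b i), ?_, ⟨?_, ?_⟩,
      (hmon b hb.1).symm⟩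
    · rw [hcoe]
      rintro _ ⟨i, rfl⟩
      exact hb.2 i
    · have h := (hb.1.map' _
        (LinearMap.ker_eq_bot.2 linearCombination_X_injective)).linearIndepOn_id
      rw [← hcoe] at h
      exact h
    · intro ψ hψ
      obtain ⟨v, rfl⟩ := mem_range_linearCombination_X.2 hψ
      rw [hcoe, Set.range_comp, ← Submodule.map_span,
        hb.1.span_eq_top_of_card_eq_finrank' (by simp)]
      exact Submodule.mem_map_of_mem trivial

variable [IsFractionRing (MvPolynomial (Fin n) k) L]

lemma mul_zpow_mem_laurentSpan {Δ : Set (MvPolynomial (Fin n) k)} {u : Fin n → k} (hu : u ≠ 0)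
    (huΔ : Fintype.linearCombination k X u ∈ Δ) (q : ℤ) {f : L} (hf : f ∈ laurentSpan L Δ) :
    f * Fintype.linearCombination k (fracCoordinate k L n) u ^ q ∈ laurentSpan L Δ := by
  induction hf using Submodule.span_induction with
  | zero => simp
  | add f g _ _ hf hg => rw [add_mul]; exact Submodule.add_mem _ hf hg
  | smul c f _ hf => rw [smul_mul_assoc]; exact Submodule.smul_mem _ _ hf
  | mem f hf =>
    obtain ⟨b, m, hb, rfl⟩ := hf
    exact laurentMonomial_mul_zpow_mem_laurentSpan hb hu huΔ m q

lemma exists_isBasisIn {Δ : Set (MvPolynomial (Fin n) k)} (hhom : ∀ φ ∈ Δ, φ.IsHomogeneous 1)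
    (hspan : ∀ ψ : MvPolynomial (Fin n) k, ψ.IsHomogeneous 1 → ψ ∈ Submodule.span k Δ) :
    ∃ b, IsBasisIn Δ b := by
  obtain ⟨s, hs, hsp, hli⟩ := exists_linearIndependent k (Fintype.linearCombination k X ⁻¹' Δ)
  rw [span_preimage_linearCombination_X hhom hspan] at hsp
  obtain ⟨b, hb, hr⟩ := exists_basis_range_eq hli hsp
  exact ⟨b, hb, fun i => hs (hr ▸ Set.mem_range_self i)⟩

lemma Rdelta_le_laurentSpan {Δ : Finset (MvPolynomial (Fin n) k)} (h0 : 0 ∉ Δ)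
    (hhom : ∀ φ ∈ Δ, φ.IsHomogeneous 1)
    (hspan : ∀ ψ : MvPolynomial (Fin n) k, ψ.IsHomogeneous 1 →
      ψ ∈ Submodule.span k (Δ : Set (MvPolynomial (Fin n) k))) :
    Rdelta k L Δ ≤ laurentSpan L (Δ : Set (MvPolynomial (Fin n) k)) := by
  classical
  refine Submodule.span_le.2 ?_
  rintro _ ⟨P, nn, rfl⟩
  rw [div_eq_mul_inv]
  refine algebraMap_mul_mem_laurentSpan P ?_
  suffices h : ∀ s ⊆ Δ, (∏ φ ∈ s, algebraMap (MvPolynomial (Fin n) k) L φ ^ nn φ)⁻¹ ∈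
      laurentSpan L (Δ : Set (MvPolynomial (Fin n) k)) from h Δ subset_rfl
  intro s hs
  induction s using Finset.induction_on with
  | empty =>
    obtain ⟨b, hb⟩ := exists_isBasisIn (Δ := (Δ : Set (MvPolynomial (Fin n) k))) hhom hspan
    exact Submodule.subset_span ⟨b, 0, hb, by simp [laurentMonomial]⟩
  | insert φ s hφ ih =>
    have hφΔ := hs (mem_insert_self φ s)
    obtain ⟨u, rfl⟩ := mem_range_linearCombination_X.2 (hhom φ hφΔ)
    rw [prod_insert hφ, mul_comm, mul_inv, algebraMap_linearCombination_X, ← zpow_natCast,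
      ← zpow_neg]
    refine mul_zpow_mem_laurentSpan ?_ hφΔ _ (ih ((subset_insert _ _).trans hs))
    rintro rfl
    exact h0 (by simpa using hφΔ)

lemma laurentSpan_le_Rdelta (Δ : Finset (MvPolynomial (Fin n) k)) :
    laurentSpan L (Δ : Set (MvPolynomial (Fin n) k)) ≤ Rdelta k L Δ := by
  classical
  refine Submodule.span_le.2 ?_
  rintro _ ⟨b, m, hb, rfl⟩
  refine Submodule.subset_span ⟨∏ i, Fintype.linearCombination k X (b i) ^ (m i).toNat,
    fun φ => ∑ i with Fintype.linearCombination k X (b i) = φ, (-m i).toNat, ?_⟩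
  have h : ∏ φ ∈ Δ, algebraMap (MvPolynomial (Fin n) k) L φ ^
        (∑ i with Fintype.linearCombination k X (b i) = φ, (-m i).toNat) =
      ∏ i, algebraMap (MvPolynomial (Fin n) k) L (Fintype.linearCombination k X (b i)) ^
        (-m i).toNat := by
    rw [← prod_fiberwise_of_maps_to (s := univ) (t := Δ)
      (g := fun i => Fintype.linearCombination k X (b i)) (fun i _ => hb.2 i)]
    refine prod_congr rfl fun φ _ => ?_
    rw [← prod_pow_eq_pow_sum]
    exact prod_congr rfl fun i hi => by rw [(mem_filter.1 hi).2]
  rw [h, map_prod, ← prod_div_distrib]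
  refine prod_congr rfl fun i _ => ?_
  rw [map_pow, algebraMap_linearCombination_X, ← zpow_natCast, ← zpow_natCast,
    ← zpow_sub₀ (linearCombination_fracCoordinate_ne_zero (hb.1.ne_zero i))]
  congr 1
  omega

end Comparison

section Derivatives

open Finset

variable {k : Type*} [Field k] {n : ℕ} {L : Type*} [Field L] [Algebra k L]

lemma derivation_prod_zpow {ι : Type*} (E : Derivation k L L) {f : ι → L} (hf : ∀ i, f i ≠ 0)
    (m : ι → ℤ) (s : Finset ι) :
    E (∏ i ∈ s, f i ^ m i) =
      ∑ i ∈ s, m i * E (f i) * ((∏ j ∈ s, f j ^ m j) * f i ^ (-1 : ℤ)) := by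
  classical
  induction s using Finset.induction_on with
  | empty => simp
  | insert i s hi ih =>
    rw [prod_insert hi, E.leibniz, ih, sum_insert hi, Derivation.leibniz_zpow, add_comm,
      smul_eq_mul, smul_eq_mul, smul_eq_mul, mul_sum, zsmul_eq_mul, zpow_sub_one₀ (hf i),
      zpow_neg_one]
    congr 1
    · ring
    · exact sum_congr rfl fun j _ => by ring

variable [Algebra (MvPolynomial (Fin n) k) L]
  [IsScalarTower k (MvPolynomial (Fin n) k) L] [IsFractionRing (MvPolynomial (Fin n) k) L]

lemma leibniz_laurentMonomial {D : L →ₗ[k] L} (hLeib : ∀ f g, D (f * g) = f * D g + g * D f)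
    {c : (Fin n → k) → k}
    (hc : ∀ v, D (Fintype.linearCombination k (fracCoordinate k L n) v) = algebraMap k L (c v))
    {b : Fin n → Fin n → k} (hb : LinearIndependent k b) (m : Fin n → ℤ) :
    D (laurentMonomial k (fracCoordinate k L n) b m) = ∑ i, ((m i : k) * c (b i)) •
      laurentMonomial k (fracCoordinate k L n) b (m + Pi.single i (-1)) := by
  have hne (i) := linearCombination_fracCoordinate_ne_zero (L := L) (hb.ne_zero i)
  have h := derivation_prod_zpow (Derivation.mk' D hLeib) hne m univ
  refine h.trans (sum_congr rfl fun i _ => ?_)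
  rw [← laurentMonomial_mul_zpow (hne i), Derivation.coe_mk', hc, Algebra.smul_def, map_mul,
    map_intCast, laurentMonomial]

lemma map_laurentSpan_le {D : L →ₗ[k] L} (hLeib : ∀ f g, D (f * g) = f * D g + g * D f)
    {c : (Fin n → k) → k}
    (hc : ∀ v, D (Fintype.linearCombination k (fracCoordinate k L n) v) = algebraMap k L (c v))
    (Δ : Set (MvPolynomial (Fin n) k)) :
    (laurentSpan L Δ).map D ≤ laurentSpan L Δ := by
  rw [laurentSpan, Submodule.map_span_le]
  rintro _ ⟨b, m, hb, rfl⟩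
  rw [leibniz_laurentMonomial hLeib hc hb.1]
  exact Submodule.sum_mem _ fun i _ =>
    Submodule.smul_mem _ _ (Submodule.subset_span ⟨b, _, hb, rfl⟩)

lemma map_laurentSpan_le_nonsimpleMonomialSpan {D : L →ₗ[k] L}
    (hLeib : ∀ f g, D (f * g) = f * D g + g * D f) {c : (Fin n → k) → k}
    (hc : ∀ v, D (Fintype.linearCombination k (fracCoordinate k L n) v) = algebraMap k L (c v))
    (Δ : Set (MvPolynomial (Fin n) k)) :
    (laurentSpan L Δ).map D ≤ nonsimpleMonomialSpan k (fracCoordinate k L n) := by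
  rw [laurentSpan, Submodule.map_span_le]
  rintro _ ⟨b, m, hb, rfl⟩
  rw [leibniz_laurentMonomial hLeib hc hb.1]
  refine Submodule.sum_mem _ fun i _ => ?_
  by_cases hm : m i = 0
  · simp [hm]
  refine Submodule.smul_mem _ _ (Submodule.subset_span ⟨b, _, hb.1, fun h => hm ?_, rfl⟩)
  simpa using congrFun h i

/-- Constant vector fields dual to a basis integrate every Laurent monomial which is not a simple
fraction. -/
lemma laurentMonomial_mem_iSup_map [CharZero k] {D : Fin n → L →ₗ[k] L}
    (hLeib : ∀ i f g, D i (f * g) = f * D i g + g * D i f)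
    (hD : ∀ i v, D i (Fintype.linearCombination k (fracCoordinate k L n) v) = algebraMap k L (v i))
    {Δ : Set (MvPolynomial (Fin n) k)} {b : Fin n → Fin n → k} (hb : IsBasisIn Δ b)
    {m : Fin n → ℤ} (hm : m ≠ fun _ => -1) :
    laurentMonomial k (fracCoordinate k L n) b m ∈ ⨆ i, (laurentSpan L Δ).map (D i) := by
  obtain ⟨l, hl⟩ := Function.ne_iff.1 hm
  have hsp : ⊤ ≤ Submodule.span k (Set.range b) :=
    (hb.1.span_eq_top_of_card_eq_finrank' (by simp)).ge
  let g : (Fin n → k) →ₗ[k] k := (Module.Basis.mk hb.1 hsp).coord l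
  have hg (i) : g (b i) = if i = l then 1 else 0 := by
    have := (Module.Basis.mk hb.1 hsp).repr_self i
    rw [Module.Basis.mk_apply] at this
    simp [g, this, Finsupp.single_apply]
  let E : L →ₗ[k] L := ∑ j, g (Pi.single j 1) • D j
  have hE (f : L) : E f = ∑ j, g (Pi.single j 1) • D j f := by simp [E]
  have hELeib (f f' : L) : E (f * f') = f * E f' + f' * E f := by
    simp only [hE, hLeib, smul_add, sum_add_distrib, mul_sum, mul_smul_comm]
  have hEg (v : Fin n → k) :
      E (Fintype.linearCombination k (fracCoordinate k L n) v) = algebraMap k L (g v) := by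
    have hv : g v = ∑ j, g (Pi.single j 1) * v j := by
      conv_lhs => rw [← univ_sum_single v, map_sum]
      refine sum_congr rfl fun j _ => ?_
      rw [mul_comm, ← smul_eq_mul, ← map_smul, ← Pi.single_smul, smul_eq_mul, mul_one]
    simp only [hE, hD, hv, map_sum, map_mul, Algebra.smul_def]
  have hmem : E (laurentMonomial k (fracCoordinate k L n) b (m + Pi.single l 1)) ∈
      ⨆ i, (laurentSpan L Δ).map (D i) := by
    rw [hE]
    exact Submodule.sum_mem _ fun j _ => Submodule.smul_mem _ _ (Submodule.mem_iSup_of_mem j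
      (Submodule.mem_map_of_mem (Submodule.subset_span ⟨b, _, hb, rfl⟩)))
  rw [leibniz_laurentMonomial hELeib hEg hb.1, sum_eq_single l (fun i _ hi => by simp [hg, hi])
    (by simp), add_assoc, ← Pi.single_add] at hmem
  have hne : (((m + Pi.single l 1 : Fin n → ℤ) l : ℤ) : k) ≠ 0 := by
    have : m l + 1 ≠ 0 := fun h => hl (by omega)
    simpa using (Int.cast_ne_zero (α := k)).2 this
  simp only [hg, if_true, mul_one, add_neg_cancel, Pi.single_zero, add_zero] at hmem
  exact (Submodule.smul_mem_iff _ hne).1 hmem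

end Derivatives

/-- Brion–Vergne: `R_Δ = S_Δ ⊕ Σ_i ∂_i R_Δ`. -/
theorem brion_vergne_total_residue_decomposition
    [CharZero K] [IsFractionRing (MvPolynomial (Fin r) K) F]
    (D : Fin r → F →ₗ[K] F)
    (hLeib : ∀ i (a b : F), D i (a * b) = a * D i b + b * D i a)
    (hD : ∀ i (p : MvPolynomial (Fin r) K),
      D i (algebraMap (MvPolynomial (Fin r) K) F p) =
        algebraMap (MvPolynomial (Fin r) K) F (pderiv i p))
    (Δ : Finset (MvPolynomial (Fin r) K))
    (hΔ0 : (0 : MvPolynomial (Fin r) K) ∉ Δ)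
    (hΔhom : ∀ φ ∈ Δ, MvPolynomial.IsHomogeneous φ 1)
    (hΔspan : ∀ ψ : MvPolynomial (Fin r) K, ψ.IsHomogeneous 1 →
      ψ ∈ Submodule.span K (Δ : Set (MvPolynomial (Fin r) K))) :
    Rdelta K F Δ = Sdelta K F Δ ⊔ (⨆ i, Submodule.map (D i) (Rdelta K F Δ)) ∧
    Sdelta K F Δ ⊓ (⨆ i, Submodule.map (D i) (Rdelta K F Δ)) = ⊥ := by
  have hDv (i : Fin r) (v : Fin r → K) :
      D i (Fintype.linearCombination K (fracCoordinate K F r) v) = algebraMap K F (v i) := by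
    rw [← algebraMap_linearCombination_X, hD, Fintype.linearCombination_apply, map_sum,
      Finset.sum_eq_single i (fun j _ hj => by simp [pderiv_X, hj]) (by simp),
      Derivation.map_smul, pderiv_X_self, Algebra.smul_def, mul_one,
      ← IsScalarTower.algebraMap_apply]
  have hR : Rdelta K F Δ = laurentSpan F (Δ : Set (MvPolynomial (Fin r) K)) :=
    le_antisymm (Rdelta_le_laurentSpan hΔ0 hΔhom hΔspan) (laurentSpan_le_Rdelta Δ)
  have hS := Sdelta_eq_span (L := F) hΔhom
  rw [hR]
  refine ⟨le_antisymm (Submodule.span_le.2 ?_) (sup_le ?_ (iSup_le fun i => ?_)),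
    disjoint_iff.1 ((disjoint_simpleFractionSpan (n := r)).mono ?_ (iSup_le fun i => ?_))⟩
  · rintro _ ⟨b, m, hb, rfl⟩
    by_cases hm : m = fun _ => -1
    · refine Submodule.mem_sup_left ?_
      rw [hS, hm]
      exact Submodule.subset_span ⟨b, hb, rfl⟩
    · exact Submodule.mem_sup_right (laurentMonomial_mem_iSup_map hLeib hDv hb hm)
  · rw [hS, Submodule.span_le]
    rintro _ ⟨b, hb, rfl⟩
    exact Submodule.subset_span ⟨b, _, hb, rfl⟩
  · exact map_laurentSpan_le (hLeib i) (hDv i) _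
  · rw [hS, Submodule.span_le]
    rintro _ ⟨b, hb, rfl⟩
    exact Submodule.subset_span ⟨b, hb.1, rfl⟩
  · exact map_laurentSpan_le_nonsimpleMonomialSpan (hLeib i) (hDv i) _

end
end

section
/- Let K be a field of characteristic zero and F the field of fractions of K[z_1,…,z_r]. Let ψ_1,…,ψ_M be nonzero linear forms that do NOT span the K-vector space of linear forms, let n_1,…,n_M be positive integers, and let P ∈ K[z_1,…,z_r]. Then f = P / ∏_{k=1}^M ψ_k^{n_k} can be written as f = Σ_{i=1}^r ∂_i g_i, where each g_i ∈ F is of the form Q_i / ∏_{k=1}^M ψ_k^{m_{ik}} for some polynomial Q_i and nonnegative integers m_{ik}, and ∂_i denotes the partial derivative with respect to z_i extended to F by the quotient rule. -/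
open MvPolynomial

/-- Let `δ` be a derivation with a slice `x`, over a field of characteristic zero. If some iterate
of `δ` kills `p`, then `δ` hits every `x ^ k * p`. -/
theorem Derivation.pow_mul_mem_range_of_iterate_eq_zero {K A : Type*} [Field K] [CharZero K]
    [CommRing A] [Algebra K A] (δ : Derivation K A A) {x : A} (hx : δ x = 1) (n : ℕ) :
    ∀ (p : A) (k : ℕ), δ^[n] p = 0 → ∃ q, δ q = x ^ k * p := by
  induction n with
  | zero => exact fun p k hp => ⟨0, by simp_all⟩
  | succ n ih =>
    intro p k hp
    obtain ⟨q, hq⟩ := ih (δ p) (k + 1) hp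
    have hk : ((k + 1 : ℕ) : K) ≠ 0 := Nat.cast_ne_zero.mpr k.succ_ne_zero
    refine ⟨((k + 1 : ℕ) : K)⁻¹ • (x ^ (k + 1) * p - q), ?_⟩
    rw [δ.map_smul, δ.map_sub, δ.leibniz, hq, δ.leibniz_pow, hx, inv_smul_eq_iff₀ hk]
    rw [Nat.cast_smul_eq_nsmul, Nat.add_sub_cancel]
    simp only [smul_eq_mul, nsmul_eq_mul, Nat.cast_add, Nat.cast_one]
    ring

namespace MvPolynomial

variable {σ K : Type*} [Fintype σ] [Field K]

/-- The derivative of polynomials in the direction `v`. -/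
noncomputable def directionalDerivation (v : σ → K) :
    Derivation K (MvPolynomial σ K) (MvPolynomial σ K) :=
  mkDerivation K fun i => C (v i)

theorem directionalDerivation_apply (v : σ → K) (p : MvPolynomial σ K) :
    directionalDerivation v p = ∑ i, v i • pderiv i p := by
  classical
  have h : directionalDerivation v = ∑ i, v i • pderiv i := by
    refine derivation_ext fun j => ?_
    simp [directionalDerivation, mkDerivation_X,
      ← Derivation.coeFnAddMonoidHom_apply (∑ i, _), pderiv_X, Pi.single_apply, smul_eq_C_mul]
  rw [h, ← Derivation.coeFnAddMonoidHom_apply, map_sum, Finset.sum_apply]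
  rfl

theorem IsHomogeneous.directionalDerivation {p : MvPolynomial σ K} {n : ℕ}
    (hp : p.IsHomogeneous n) (v : σ → K) :
    (directionalDerivation v p).IsHomogeneous (n - 1) := by
  rw [directionalDerivation_apply]
  refine IsHomogeneous.sum _ _ _ fun i _ => ?_
  rw [smul_eq_C_mul]
  exact hp.pderiv.C_mul _

theorem IsHomogeneous.iterate_directionalDerivation_eq_zero {n : ℕ} (v : σ → K) :
    ∀ {p : MvPolynomial σ K}, p.IsHomogeneous n →
      (MvPolynomial.directionalDerivation v)^[n + 1] p = 0 := by
  induction n with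
  | zero =>
    intro p hp
    rw [← totalDegree_zero_iff_isHomogeneous, totalDegree_eq_zero_iff_eq_C] at hp
    rw [hp, zero_add, Function.iterate_one, ← algebraMap_eq, Derivation.map_algebraMap]
  | succ n ih =>
    intro p hp
    exact ih (hp.directionalDerivation v)

theorem directionalDerivation_surjective [CharZero K] {v : σ → K} (hv : v ≠ 0) :
    Function.Surjective (directionalDerivation v) := by
  obtain ⟨i, hi⟩ := Function.ne_iff.mp hv
  have hx : directionalDerivation v ((v i)⁻¹ • X i) = 1 := by
    rw [Derivation.map_smul, directionalDerivation, mkDerivation_X, smul_eq_C_mul, ← C_mul,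
      inv_mul_cancel₀ hi, C_1]
  intro p
  choose q hq using fun n => (directionalDerivation v).pow_mul_mem_range_of_iterate_eq_zero hx
    (n + 1) (homogeneousComponent n p) 0
    ((homogeneousComponent_isHomogeneous n p).iterate_directionalDerivation_eq_zero v)
  refine ⟨∑ n ∈ Finset.range (p.totalDegree + 1), q n, ?_⟩
  simp_rw [map_sum, hq, pow_zero, one_mul, sum_homogeneousComponent]

theorem IsHomogeneous.directionalDerivation_eq_C {p : MvPolynomial σ K} (hp : p.IsHomogeneous 1)
    (f : MvPolynomial σ K →ₗ[K] K) :
    MvPolynomial.directionalDerivation (fun i => f (X i)) p = C (f p) := by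
  have hc (i : σ) : ∃ c, pderiv i p = C c :=
    ⟨_, totalDegree_eq_zero_iff_eq_C.mp ((totalDegree_zero_iff_isHomogeneous _).mpr hp.pderiv)⟩
  choose c hc using hc
  have hsum : p = ∑ i, c i • X i := by
    have h := hp.sum_X_mul_pderiv
    simp_rw [hc, one_smul, mul_comm (X _) (C _), ← smul_eq_C_mul] at h
    exact h.symm
  rw [directionalDerivation_apply, congrArg f hsum, map_sum, map_sum]
  refine Finset.sum_congr rfl fun i _ => ?_
  rw [hc, smul_eq_C_mul, ← map_mul, map_smul, smul_eq_mul, mul_comm]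

/-- Linear forms that do not span all linear forms are killed by some nonzero directional
derivative. -/
theorem exists_directionalDerivation_eq_zero {S : Set (MvPolynomial σ K)}
    (hS : ∀ p ∈ S, p.IsHomogeneous 1)
    (hspan : ¬ ∀ χ : MvPolynomial σ K, χ.IsHomogeneous 1 → χ ∈ Submodule.span K S) :
    ∃ v : σ → K, v ≠ 0 ∧ ∀ p ∈ S, directionalDerivation v p = 0 := by
  push Not at hspan
  obtain ⟨χ, hχ, hχS⟩ := hspan
  obtain ⟨f, hfχ, hf⟩ := Submodule.exists_le_ker_of_notMem hχS
  refine ⟨fun i => f (X i), fun hv => hfχ ?_, fun p hp => ?_⟩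
  · have h := hχ.directionalDerivation_eq_C f
    rw [hv, directionalDerivation_apply] at h
    simpa using h.symm
  · rw [(hS p hp).directionalDerivation_eq_C, hf (Submodule.subset_span hp), C_0]

end MvPolynomial

/-- a rational function whose denominator is a product of linear forms that
do not span the space of linear forms is a sum of partial derivatives of rational
functions with poles on the same hyperplanes. -/
theorem nonspanning_denominator_is_sum_of_derivatives
    {r M : ℕ} (K : Type*) [Field K] [CharZero K] (F : Type*) [Field F]
    [Algebra (MvPolynomial (Fin r) K) F] [Algebra K F]
    [IsScalarTower K (MvPolynomial (Fin r) K) F]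
    [IsFractionRing (MvPolynomial (Fin r) K) F]
    (D : Fin r → F →ₗ[K] F)
    (hLeib : ∀ i (a b : F), D i (a * b) = a * D i b + b * D i a)
    (hD : ∀ i (p : MvPolynomial (Fin r) K),
      D i (algebraMap (MvPolynomial (Fin r) K) F p) =
        algebraMap (MvPolynomial (Fin r) K) F (pderiv i p))
    (ψ : Fin M → MvPolynomial (Fin r) K)
    (hψ0 : ∀ k, ψ k ≠ 0) (hψhom : ∀ k, (ψ k).IsHomogeneous 1)
    (hnospan : ¬ ∀ χ : MvPolynomial (Fin r) K, χ.IsHomogeneous 1 →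
      χ ∈ Submodule.span K (Set.range ψ))
    (nk : Fin M → ℕ) (hnk : ∀ k, 0 < nk k)
    (P : MvPolynomial (Fin r) K) :
    ∃ g : Fin r → F,
      (algebraMap (MvPolynomial (Fin r) K) F P /
          ∏ k, (algebraMap (MvPolynomial (Fin r) K) F (ψ k)) ^ (nk k))
        = ∑ i, D i (g i) ∧
      ∀ i, ∃ (Q : MvPolynomial (Fin r) K) (mm : Fin M → ℕ),
        g i = algebraMap (MvPolynomial (Fin r) K) F Q /
          ∏ k, (algebraMap (MvPolynomial (Fin r) K) F (ψ k)) ^ (mm k) := by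
  obtain ⟨v, hv, hvψ⟩ := exists_directionalDerivation_eq_zero
    (Set.forall_mem_range.mpr hψhom) hnospan
  rw [Set.forall_mem_range] at hvψ
  obtain ⟨Q, rfl⟩ := directionalDerivation_surjective hv P
  let δ : Derivation K F F := Derivation.mk' (∑ i, v i • D i) fun a b => by
    simp [hLeib, Finset.mul_sum, Finset.sum_add_distrib, smul_add]
  have hδ (a : F) : δ a = ∑ i, D i (v i • a) := by simp [δ]
  have hδ_map (p : MvPolynomial (Fin r) K) :
      δ (algebraMap _ F p) = algebraMap _ F (directionalDerivation v p) := by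
    simp only [hδ, directionalDerivation_apply, map_smul, map_sum, hD]
    simp [Algebra.smul_def, IsScalarTower.algebraMap_apply K (MvPolynomial (Fin r) K) F]
  have hden : directionalDerivation v (∏ k, ψ k ^ nk k) = 0 := by
    refine Finset.prod_induction _ (fun p => directionalDerivation v p = 0) ?_ ?_ ?_
    · intro a b ha hb
      rw [Derivation.leibniz, ha, hb, smul_zero, smul_zero, add_zero]
    · exact Derivation.map_one_eq_zero _
    · intro k _
      rw [Derivation.leibniz_pow, hvψ, smul_zero, smul_zero]
  refine ⟨fun i => v i • (algebraMap _ F Q / ∏ k, algebraMap _ F (ψ k) ^ nk k), ?_,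
    fun i => ⟨C (v i) * Q, nk, ?_⟩⟩
  · simp_rw [← map_pow, ← map_prod]
    rw [← hδ, δ.leibniz_div_const _ _ (by rw [hδ_map, hden, map_zero]), hδ_map, smul_eq_mul,
      div_eq_inv_mul]
  · beta_reduce
    rw [Algebra.smul_def, IsScalarTower.algebraMap_apply K (MvPolynomial (Fin r) K) F, map_mul,
      algebraMap_eq, mul_div_assoc]
end

section
/- Let r ≥ 1 and work in the field F of rational functions in variables z_1,…,z_r over ℚ. Let Δ = {z_i : 1 ≤ i ≤ r} ∪ {z_i − z_j : 1 ≤ i < j ≤ r}. Call σ ⊆ Δ basic if σ consists of r linearly independent linear forms, and set f_σ = (∏_{φ∈σ} φ)^{−1}; let S_{A_r} be the ℚ-linear span of all f_σ. For a permutation w of {1,…,r} set f_w = ((z_{w(1)} − z_{w(2)})(z_{w(2)} − z_{w(3)}) ⋯ (z_{w(r−1)} − z_{w(r)}) · z_{w(r)})^{−1}. Then the family (f_w), indexed by the r! permutations w, is linearly independent over ℚ and spans S_{A_r}; in particular dim_ℚ S_{A_r} = r!. -/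
open MvPolynomial

noncomputable section

/-- The polynomial ring `ℚ[z_1, …, z_r]` with `r = n + 1`. -/
abbrev Rpoly (n : ℕ) := MvPolynomial (Fin (n + 1)) ℚ

/-- The field of rational functions in `r = n + 1` variables over `ℚ`. -/
abbrev Ffield (n : ℕ) := FractionRing (Rpoly n)

/-- The arrangement `Δ = {z_i} ∪ {z_i - z_j : i < j}` of type `A_r` linear forms. -/
def deltaAr (n : ℕ) : Set (Rpoly n) :=
  {p | (∃ i, p = X i) ∨ ∃ i j : Fin (n + 1), i < j ∧ p = X i - X j}

/-- `S_{A_r}`: the span of the simple fractions `f_σ = 1/∏_{φ ∈ σ} φ` over the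
basic subsets `σ` (sets of `r` linearly independent forms from `Δ`). -/
def SAr (n : ℕ) : Submodule ℚ (Ffield n) :=
  Submodule.span ℚ {f : Ffield n | ∃ σ : Finset (Rpoly n),
    (σ : Set (Rpoly n)) ⊆ deltaAr n ∧ σ.card = n + 1 ∧
    LinearIndependent ℚ (Subtype.val : {x // x ∈ σ} → Rpoly n) ∧
    f = (∏ φ ∈ σ, algebraMap (Rpoly n) (Ffield n) φ)⁻¹}

/-- The simple fraction
`f_w = 1/((z_{w(1)}-z_{w(2)})⋯(z_{w(r-1)}-z_{w(r)}) z_{w(r)})` attached to a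
permutation `w` of `{1, …, r}`. -/
def fperm (n : ℕ) (w : Equiv.Perm (Fin (n + 1))) : Ffield n :=
  ((∏ i : Fin n, algebraMap (Rpoly n) (Ffield n) (X (w i.castSucc) - X (w i.succ))) *
    algebraMap (Rpoly n) (Ffield n) (X (w (Fin.last n))))⁻¹

/-- Any `ℚ`-module structure on a field acts through the canonical map from `ℚ`. -/
theorem rat_module_smul_eq {K : Type*} [Field K] [CharZero K] (inst : Module ℚ K) (q : ℚ) (x : K) :
    @HSMul.hSMul ℚ K K (@instHSMul ℚ K inst.toDistribMulAction.toMulAction.toSMul) q x =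
      (q : K) * x := by
  obtain rfl : inst = DivisionRing.toRatAlgebra.toModule := Subsingleton.elim _ _
  exact Rat.smul_def q x

theorem ratCast_mul_mem {K : Type*} [Field K] [CharZero K] {inst : Module ℚ K}
    (p : Submodule ℚ K) (q : ℚ) {x : K} (hx : x ∈ p) : (q : K) * x ∈ p := by
  rw [← rat_module_smul_eq inst]
  exact p.smul_mem q hx

theorem linearIndependent_of_ratCast_mul {K κ : Type*} [Field K] [CharZero K] [Fintype κ]
    {inst : Module ℚ K} {f : κ → K} (h : ∀ c : κ → ℚ, ∑ i, (c i : K) * f i = 0 → ∀ i, c i = 0) :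
    LinearIndependent ℚ f :=
  Fintype.linearIndependent_iff.2 fun c hc => h c (by simpa only [rat_module_smul_eq] using hc)

section ChainFractions

variable {K ι : Type*} [Field K] [CharZero K] [Module ℚ K]

/-- The chain fraction `1 / ((z_{x₁} - c) (z_{x₂} - z_{x₁}) ⋯ (z_{x_k} - z_{x_{k-1}}))` attached to
a starting value `c` and a list `[x₁, …, x_k]` of indices. -/
def chainFrac (z : ι → K) : K → List ι → K
  | _, [] => 1
  | c, x :: l => (z x - c)⁻¹ * chainFrac z (z x) l

/-- The span of the chain fractions attached to the rearrangements of `l`. -/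
def chainSpan (z : ι → K) (c : K) (l : List ι) : Submodule ℚ K :=
  Submodule.span ℚ {y | ∃ l', l'.Perm l ∧ y = chainFrac z c l'}

theorem inv_mul_mem_chainSpan {z : ι → K} {c y : K} {x : ι} {l m : List ι}
    (hm : (x :: l).Perm m) (hy : y ∈ chainSpan z (z x) l) :
    (z x - c)⁻¹ * y ∈ chainSpan z c m := by
  induction hy using Submodule.span_induction with
  | mem y hy =>
    obtain ⟨l', hl', rfl⟩ := hy
    exact Submodule.subset_span ⟨x :: l', (hl'.cons x).trans hm, rfl⟩
  | zero => simp
  | add y y' _ _ hy hy' => rw [mul_add]; exact add_mem hy hy'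
  | smul q y _ hy => rw [rat_module_smul_eq, mul_left_comm]; exact ratCast_mul_mem _ _ hy

/-- Attaching a new vertex `a` to any vertex of a chain gives a combination of longer chains. -/
theorem chainFrac_mul_inv_mem {z : ι → K} (hz : z.Injective) {a : ι} (l : List ι) :
    ∀ c : K, (a :: l).Nodup → z a ≠ c → (∀ i ∈ l, z i ≠ c) → ∀ d, (d = c ∨ ∃ j ∈ l, d = z j) →
      chainFrac z c l * (z a - d)⁻¹ ∈ chainSpan z c (a :: l) := by
  induction l with
  | nil =>
    rintro c - - - d (rfl | ⟨j, hj, -⟩)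
    · exact Submodule.subset_span ⟨[a], .refl _, by simp [chainFrac]⟩
    · simp at hj
  | cons x t ih =>
    intro c hn hac hc d hd
    simp only [List.nodup_cons, List.mem_cons, not_or] at hn
    obtain ⟨⟨hax, hat⟩, hxt, ht⟩ := hn
    have hzax : z a ≠ z x := fun h => hax (hz h)
    have hxc : z x ≠ c := hc x (by simp)
    have key : ∀ d, (d = z x ∨ ∃ j ∈ t, d = z j) →
        chainFrac z c (x :: t) * (z a - d)⁻¹ ∈ chainSpan z c (a :: x :: t) := by
      intro d hd
      have h := ih (z x) (by simp [hat, ht]) hzax (fun i hi h => hxt (hz h ▸ hi)) d hd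
      have := inv_mul_mem_chainSpan (c := c) (.swap a x t) h
      rwa [← mul_assoc] at this
    rcases hd with rfl | ⟨j, hj, rfl⟩
    · have e : chainFrac z d (x :: t) * (z a - d)⁻¹ =
          chainFrac z d (x :: t) * (z a - z x)⁻¹ + chainFrac z d (a :: x :: t) := by
        have h1 : z a - d ≠ 0 := sub_ne_zero.2 hac
        have h2 : z x - d ≠ 0 := sub_ne_zero.2 hxc
        have h3 : z a - z x ≠ 0 := sub_ne_zero.2 hzax
        have h4 : z x - z a ≠ 0 := sub_ne_zero.2 hzax.symm
        simp only [chainFrac]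
        field_simp
        ring
      rw [e]
      exact add_mem (key _ (.inl rfl)) (Submodule.subset_span ⟨_, .refl _, rfl⟩)
    · rcases List.mem_cons.1 hj with rfl | hj
      · exact key _ (.inl rfl)
      · exact key _ (.inr ⟨j, hj, rfl⟩)

theorem mul_inv_mem_chainSpan {z : ι → K} (hz : z.Injective) {a : ι} {l : List ι} {c d y : K}
    (hn : (a :: l).Nodup) (hc : ∀ i, z i ≠ c) (hd : d = c ∨ ∃ j ∈ l, d = z j)
    (hy : y ∈ chainSpan z c l) : y * (z a - d)⁻¹ ∈ chainSpan z c (a :: l) := by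
  induction hy using Submodule.span_induction with
  | mem y hy =>
    obtain ⟨l', hl', rfl⟩ := hy
    have h := chainFrac_mul_inv_mem hz l' c ((hl'.cons a).nodup_iff.2 hn) (hc a)
      (fun i _ => hc i) d (by simpa only [hl'.mem_iff] using hd)
    refine Submodule.span_mono ?_ h
    rintro _ ⟨m, hm, rfl⟩
    exact ⟨m, hm.trans (hl'.cons a), rfl⟩
  | zero => simp
  | add y y' _ _ hy hy' => rw [add_mul]; exact add_mem hy hy'
  | smul q y _ hy => rw [rat_module_smul_eq, mul_assoc]; exact ratCast_mul_mem _ _ hy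

omit [CharZero K] [Module ℚ K] in
theorem chainFrac_ofFn (z : ι → K) {k : ℕ} (c : K) (f : Fin (k + 1) → ι) :
    chainFrac z c (List.ofFn f) =
      ((∏ i : Fin k, (z (f i.succ) - z (f i.castSucc))) * (z (f 0) - c))⁻¹ := by
  induction k generalizing c with
  | zero => simp [chainFrac]
  | succ k ih =>
    rw [List.ofFn_succ, chainFrac, ih, Fin.prod_univ_succ, ← mul_inv]
    simp only [Fin.succ_castSucc, Fin.castSucc_zero]
    congr 1
    ring

end ChainFractions

section Spanning

variable {n : ℕ}

/-- The variable `z_i` as an element of the field of rational functions. -/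
def zvar (n : ℕ) (i : Fin (n + 1)) : Ffield n := algebraMap (Rpoly n) (Ffield n) (X i)

theorem zvar_injective : (zvar n).Injective :=
  (IsFractionRing.injective (Rpoly n) (Ffield n)).comp (X_injective (R := ℚ))

theorem zvar_ne_zero (i : Fin (n + 1)) : zvar n i ≠ 0 := by
  simp [zvar]

theorem fperm_eq_chainFrac (w : Equiv.Perm (Fin (n + 1))) :
    fperm n w = chainFrac (zvar n) 0 (List.ofFn fun i => w i.rev) := by
  rw [chainFrac_ofFn, fperm, ← Equiv.prod_comp Fin.revPerm]
  simp [zvar, Fin.rev_succ, Fin.rev_castSucc]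

theorem chainFrac_mem_span_fperm {l : List (Fin (n + 1))} (hl : l.Nodup)
    (hlen : l.length = n + 1) :
    chainFrac (zvar n) 0 l ∈ Submodule.span ℚ (Set.range (fperm n)) := by
  obtain ⟨f, rfl⟩ : ∃ f : Fin (n + 1) → Fin (n + 1), l = List.ofFn f :=
    ⟨fun i => l.get (i.cast hlen.symm), by
      rw [List.ofFn_congr hlen.symm]; simp⟩
  rw [List.nodup_ofFn] at hl
  let w : Equiv.Perm (Fin (n + 1)) :=
    Fin.revPerm.trans (Equiv.ofBijective f (Finite.injective_iff_bijective.1 hl))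
  refine Submodule.subset_span ⟨w, ?_⟩
  simp [fperm_eq_chainFrac, w]

theorem linearIndependent_X_rpoly : LinearIndependent ℚ (X : Fin (n + 1) → Rpoly n) :=
  MvPolynomial.linearIndependent_X _ _

theorem deltaAr_subset_span_X :
    deltaAr n ⊆ Submodule.span ℚ (Set.range (X : Fin (n + 1) → Rpoly n)) := by
  rintro p (⟨i, rfl⟩ | ⟨i, j, -, rfl⟩)
  · exact Submodule.subset_span ⟨i, rfl⟩
  · exact sub_mem (Submodule.subset_span ⟨i, rfl⟩) (Submodule.subset_span ⟨j, rfl⟩)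

/-- A basic subset spans all linear forms. -/
theorem span_basic {σ : Finset (Rpoly n)} (hσ : (σ : Set (Rpoly n)) ⊆ deltaAr n)
    (hc : σ.card = n + 1) (hi : LinearIndependent ℚ (Subtype.val : {x // x ∈ σ} → Rpoly n)) :
    Submodule.span ℚ (σ : Set (Rpoly n)) =
      Submodule.span ℚ (Set.range (X : Fin (n + 1) → Rpoly n)) := by
  have : FiniteDimensional ℚ (Submodule.span ℚ (Set.range (X : Fin (n + 1) → Rpoly n))) :=
    FiniteDimensional.span_of_finite ℚ (Set.finite_range _)
  refine Submodule.eq_of_le_of_finrank_eq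
    (Submodule.span_le.2 (hσ.trans deltaAr_subset_span_X)) ?_
  rw [finrank_span_eq_card linearIndependent_X_rpoly, finrank_span_finset_eq_card hi, hc]
  simp

/-- If a proper subset of the variables is given, some form of a basic subset joins it (or the
origin) to its complement. -/
theorem exists_crossing {σ : Finset (Rpoly n)} (hσ : (σ : Set (Rpoly n)) ⊆ deltaAr n)
    (hc : σ.card = n + 1) (hi : LinearIndependent ℚ (Subtype.val : {x // x ∈ σ} → Rpoly n))
    {l : List (Fin (n + 1))} {v : Fin (n + 1)} (hv : v ∉ l) :
    ∃ φ ∈ σ, (∃ x : Fin (n + 1) → ℚ, (∀ i ∈ l, x i = 0) ∧ eval x φ ≠ 0) ∧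
      ∃ a ∉ l, ∃ d : Rpoly n, (d = 0 ∨ ∃ j ∈ l, d = X j) ∧ (φ = X a - d ∨ φ = -(X a - d)) := by
  let x : Fin (n + 1) → ℚ := fun i => if i ∈ l then 0 else 1
  obtain ⟨φ, hφ, hx⟩ : ∃ φ ∈ σ, eval x φ ≠ 0 := by
    by_contra! h
    have hle : Submodule.span ℚ (σ : Set (Rpoly n)) ≤ LinearMap.ker (aeval x).toLinearMap :=
      Submodule.span_le.2 fun φ hφ => by simpa [aeval_eq_eval] using h φ hφ
    rw [span_basic hσ hc hi] at hle
    have := hle (Submodule.subset_span ⟨v, rfl⟩)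
    simp [x, hv] at this
  refine ⟨φ, hφ, ⟨x, fun i hi => by simp [x, hi], hx⟩, ?_⟩
  rcases hσ hφ with ⟨i, rfl⟩ | ⟨i, j, -, rfl⟩
  · refine ⟨i, fun hil => hx (by simp [x, hil]), 0, .inl rfl, .inl (by simp)⟩
  · by_cases hil : i ∈ l
    · refine ⟨j, fun hjl => hx (by simp [x, hil, hjl]), X i, .inr ⟨i, hil, rfl⟩, .inr (by ring)⟩
    · refine ⟨i, hil, X j, .inr ⟨j, ?_, rfl⟩, .inl rfl⟩
      by_contra hjl
      exact hx (by simp [x, hil, hjl])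

theorem exists_partial_chain {σ : Finset (Rpoly n)} (hσ : (σ : Set (Rpoly n)) ⊆ deltaAr n)
    (hc : σ.card = n + 1) (hi : LinearIndependent ℚ (Subtype.val : {x // x ∈ σ} → Rpoly n))
    (k : ℕ) (hk : k ≤ n + 1) :
    ∃ l : List (Fin (n + 1)), l.Nodup ∧ l.length = k ∧ ∃ τ ⊆ σ, τ.card = k ∧
      (∀ φ ∈ τ, ∀ x : Fin (n + 1) → ℚ, (∀ i ∈ l, x i = 0) → eval x φ = 0) ∧
      (∏ φ ∈ τ, algebraMap (Rpoly n) (Ffield n) φ)⁻¹ ∈ chainSpan (zvar n) 0 l := by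
  classical
  induction k with
  | zero =>
    exact ⟨[], by simp, rfl, ∅, by simp, rfl, by simp,
      Submodule.subset_span ⟨[], .refl _, by simp [chainFrac]⟩⟩
  | succ k ih =>
    obtain ⟨l, hl, rfl, τ, hτ, hτc, hτ0, hmem⟩ := ih (by omega)
    obtain ⟨v, hv⟩ : ∃ v, v ∉ l := by
      by_contra! h
      have := Finset.card_le_card (fun v _ => List.mem_toFinset.2 (h v) :
        (Finset.univ : Finset (Fin (n + 1))) ⊆ l.toFinset)
      have := l.toFinset_card_le
      simp at *
      omega
    obtain ⟨φ, hφ, ⟨x, hx, hxφ⟩, a, ha, d, hd, hφd⟩ := exists_crossing hσ hc hi hv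
    have hφτ : φ ∉ τ := fun h => hxφ (hτ0 φ h x hx)
    have hn : (a :: l).Nodup := by simp [ha, hl]
    refine ⟨a :: l, hn, rfl, insert φ τ, Finset.insert_subset hφ hτ,
      by simp [Finset.card_insert_of_notMem hφτ, hτc], ?_, ?_⟩
    · intro ψ hψ y hy
      simp only [List.mem_cons, forall_eq_or_imp] at hy
      rcases Finset.mem_insert.1 hψ with rfl | hψ
      · have hd0 : eval y d = 0 := by
          rcases hd with rfl | ⟨j, hj, rfl⟩
          · simp
          · simp [hy.2 j hj]
        rcases hφd with rfl | rfl <;> simp [hd0, hy.1]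
      · exact hτ0 ψ hψ y hy.2
    · have h := mul_inv_mem_chainSpan zvar_injective hn zvar_ne_zero
        (d := algebraMap (Rpoly n) (Ffield n) d) (by
          rcases hd with rfl | ⟨j, hj, rfl⟩
          · simp
          · exact .inr ⟨j, hj, rfl⟩) hmem
      rw [Finset.prod_insert hφτ, mul_inv_rev]
      rcases hφd with rfl | rfl
      · simpa [zvar] using h
      · rw [map_neg, inv_neg, mul_neg, map_sub]
        exact neg_mem h

theorem SAr_le_span_fperm : SAr n ≤ Submodule.span ℚ (Set.range (fperm n)) := by
  refine Submodule.span_le.2 ?_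
  rintro _ ⟨σ, hσ, hc, hi, rfl⟩
  obtain ⟨l, hl, hlen, τ, hτ, hτc, -, hmem⟩ := exists_partial_chain hσ hc hi (n + 1) le_rfl
  obtain rfl : τ = σ := Finset.eq_of_subset_of_card_le hτ (by omega)
  refine (Submodule.span_le.2 ?_ : chainSpan (zvar n) 0 l ≤ _) hmem
  rintro _ ⟨l', hl', rfl⟩
  exact chainFrac_mem_span_fperm (hl'.nodup_iff.2 hl) (hl'.length_eq.trans hlen)

/-- The denominators of `f_w`, normalised by a sign so that they lie in `Δ`. -/
def pathForm (w : Equiv.Perm (Fin (n + 1))) : Fin (n + 1) → Rpoly n :=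
  Fin.lastCases (X (w (Fin.last n))) fun i =>
    if w i.castSucc < w i.succ then X (w i.castSucc) - X (w i.succ)
    else X (w i.succ) - X (w i.castSucc)

theorem pathForm_mem_deltaAr (w : Equiv.Perm (Fin (n + 1))) (i : Fin (n + 1)) :
    pathForm w i ∈ deltaAr n := by
  induction i using Fin.lastCases with
  | last => exact .inl ⟨w (Fin.last n), by simp [pathForm]⟩
  | cast i =>
    simp only [pathForm, Fin.lastCases_castSucc]
    split_ifs with h
    · exact .inr ⟨_, _, h, rfl⟩
    · refine .inr ⟨_, _, lt_of_le_of_ne (not_lt.1 h) fun e => ?_, rfl⟩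
      have := w.injective e
      simp [Fin.ext_iff] at this

theorem linearIndependent_pathForm (w : Equiv.Perm (Fin (n + 1))) :
    LinearIndependent ℚ (pathForm w) := by
  rw [Fintype.linearIndependent_iff]
  intro c hc k
  let x : Fin (n + 1) → ℚ := fun j => if w.symm j ≤ k then 1 else 0
  have hne : ∀ i, i ≠ k → eval x (pathForm w i) = 0 := by
    intro i hik
    induction i using Fin.lastCases with
    | last =>
      have : ¬ Fin.last n ≤ k := fun h => hik (le_antisymm h (Fin.le_last k))
      simp only [pathForm, Fin.lastCases_last, eval_X, x, Equiv.symm_apply_apply, if_neg this]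
    | cast i =>
      have : i.castSucc ≤ k ↔ i.succ ≤ k := by
        simp only [Fin.le_def, Fin.ext_iff, ne_eq, Fin.val_castSucc, Fin.val_succ] at *
        omega
      simp only [pathForm, Fin.lastCases_castSucc]
      split_ifs <;> simp [x, this]
  have hk : eval x (pathForm w k) ≠ 0 := by
    clear hne hc
    induction k using Fin.lastCases with
    | last => simp [pathForm, x]
    | cast i =>
      have : ¬ i.succ ≤ i.castSucc := by simp [Fin.le_def]
      simp only [pathForm, Fin.lastCases_castSucc]
      split_ifs <;> simp [x, this]
  have h := congrArg (eval x) hc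
  rw [map_sum, Finset.sum_eq_single k (fun i _ hi => by simp [smul_eval, hne i hi])
    (by simp)] at h
  simpa [smul_eval, hk] using h

theorem fperm_mem_SAr (w : Equiv.Perm (Fin (n + 1))) : fperm n w ∈ SAr n := by
  classical
  have hli := linearIndependent_pathForm w
  have hmem : (∏ i, algebraMap (Rpoly n) (Ffield n) (pathForm w i))⁻¹ ∈ SAr n := by
    refine Submodule.subset_span ⟨Finset.univ.image (pathForm w), ?_, ?_, ?_, ?_⟩
    · intro p hp
      simp only [Finset.coe_image, Finset.coe_univ, Set.image_univ] at hp
      obtain ⟨i, rfl⟩ := hp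
      exact pathForm_mem_deltaAr w i
    · rw [Finset.card_image_of_injective _ hli.injective]
      simp
    · have := hli.linearIndepOn_id
      have e : (Set.range (pathForm w)) = {x | x ∈ Finset.univ.image (pathForm w)} := by
        ext; simp
      rw [e] at this
      exact this
    · rw [Finset.prod_image fun i _ j _ h => hli.injective h]
  have hsign : ∀ i : Fin n, ∃ u : ℚ, algebraMap (Rpoly n) (Ffield n)
      (X (w i.castSucc) - X (w i.succ)) =
        (u : Ffield n) * algebraMap (Rpoly n) (Ffield n) (pathForm w i.castSucc) := by
    intro i
    simp only [pathForm, Fin.lastCases_castSucc]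
    split_ifs
    · exact ⟨1, by simp⟩
    · exact ⟨-1, by simp⟩
  choose u hu using hsign
  have e : fperm n w =
      ((∏ i, u i)⁻¹ : ℚ) * (∏ i, algebraMap (Rpoly n) (Ffield n) (pathForm w i))⁻¹ := by
    rw [fperm, Finset.prod_congr rfl fun i _ => hu i, Fin.prod_univ_castSucc]
    simp only [Finset.prod_mul_distrib, mul_inv_rev, Rat.cast_inv,
      Rat.cast_prod]
    simp only [pathForm, Fin.lastCases_last]
    ring
  rw [e]
  exact ratCast_mul_mem _ _ hmem

theorem span_fperm_eq_SAr : Submodule.span ℚ (Set.range (fperm n)) = SAr n :=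
  le_antisymm (Submodule.span_le.2 (by rintro _ ⟨w, rfl⟩; exact fperm_mem_SAr w))
    SAr_le_span_fperm

end Spanning

section Independence

open Filter Topology

/-- Clearing denominators in a sum of fractions, after applying a ring homomorphism. -/
theorem prod_map_mul_sum_mul_inv {R M κ : Type*} [CommRing R] [Field M] [Fintype κ]
    [DecidableEq κ] (f : R →+* M) (c D : κ → R) (hD : ∀ k, f (D k) ≠ 0) :
    (∏ k, f (D k)) * ∑ k, f (c k) * (f (D k))⁻¹ =
      f (∑ k, c k * ∏ j ∈ Finset.univ.erase k, D j) := by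
  rw [Finset.mul_sum, map_sum]
  refine Finset.sum_congr rfl fun k _ => ?_
  rw [← Finset.mul_prod_erase _ _ (Finset.mem_univ k), map_mul, map_prod]
  have := hD k
  field_simp

/-- A linear relation between inverses in the fraction field specialises along any ring
homomorphism that kills none of the denominators. -/
theorem sum_mul_inv_map_eq_zero {R K L κ : Type*} [CommRing R] [Field K] [Algebra R K]
    [IsFractionRing R K] [Field L] [Fintype κ] (f : R →+* L) (c D : κ → R)
    (hD : ∀ k, f (D k) ≠ 0)
    (h : ∑ k, algebraMap R K (c k) * (algebraMap R K (D k))⁻¹ = 0) :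
    ∑ k, f (c k) * (f (D k))⁻¹ = 0 := by
  classical
  have hK : ∀ k, algebraMap R K (D k) ≠ 0 := fun k h0 =>
    hD k (by rw [(map_eq_zero_iff _ (IsFractionRing.injective R K)).1 h0, map_zero])
  have h1 := prod_map_mul_sum_mul_inv (algebraMap R K) c D hK
  rw [h, mul_zero, eq_comm, map_eq_zero_iff _ (IsFractionRing.injective R K)] at h1
  have h2 := prod_map_mul_sum_mul_inv f c D hD
  rw [h1, map_zero] at h2
  exact (mul_eq_zero.1 h2).resolve_left (Finset.prod_ne_zero_iff.2 fun k _ => hD k)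

theorem tendsto_pow_div_pow_sub_pow {a b : ℕ} (hab : a ≠ b) :
    Tendsto (fun t : ℝ => t ^ a / (t ^ a - t ^ b)) (𝓝[>] 0) (𝓝 (if a < b then 1 else 0)) := by
  rcases lt_or_gt_of_ne hab with h | h
  · obtain ⟨m, rfl⟩ := Nat.exists_eq_add_of_lt h
    have hc : ContinuousAt (fun t : ℝ => 1 / (1 - t ^ (m + 1))) 0 := by
      refine ContinuousAt.div (by fun_prop) (by fun_prop) (by simp)
    have := hc.tendsto.mono_left (nhdsWithin_le_nhds (s := Set.Ioi 0))
    simp only [h, if_true]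
    refine Tendsto.congr' ?_ (by simpa using this)
    filter_upwards [self_mem_nhdsWithin] with t ht
    have ht : t ^ a ≠ 0 := pow_ne_zero _ (ne_of_gt ht)
    rw [show t ^ a - t ^ (a + m + 1) = t ^ a * (1 - t ^ (m + 1)) by ring, ← div_div,
      div_self ht, one_div]
  · obtain ⟨m, rfl⟩ := Nat.exists_eq_add_of_lt h
    have hc : ContinuousAt (fun t : ℝ => t ^ (m + 1) / (t ^ (m + 1) - 1)) 0 := by
      refine ContinuousAt.div (by fun_prop) (by fun_prop) (by simp)
    have := hc.tendsto.mono_left (nhdsWithin_le_nhds (s := Set.Ioi 0))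
    simp only [h.not_gt, if_false]
    refine Tendsto.congr' ?_ (by simpa using this)
    filter_upwards [self_mem_nhdsWithin] with t ht
    have ht : t ^ b ≠ 0 := pow_ne_zero _ (ne_of_gt ht)
    rw [show t ^ (b + m + 1) - t ^ b = t ^ b * (t ^ (m + 1) - 1) by ring,
      show t ^ (b + m + 1) = t ^ b * t ^ (m + 1) by ring, mul_div_mul_left _ _ ht]

/-- The denominator of `f_w`. -/
def denom (n : ℕ) (w : Equiv.Perm (Fin (n + 1))) : Rpoly n :=
  (∏ i : Fin n, (X (w i.castSucc) - X (w i.succ))) * X (w (Fin.last n))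

theorem linearIndependent_fperm (n : ℕ) : LinearIndependent ℚ (fperm n) := by
  refine linearIndependent_of_ratCast_mul ?_
  intro c hc v
  let x : ℝ → Fin (n + 1) → ℝ := fun t j => t ^ (v.symm j : ℕ)
  have hx0 : ∀ t, 0 < t → ∀ j, x t j ≠ 0 := fun t ht j => pow_ne_zero _ ht.ne'
  have hinj : ∀ t, 0 < t → t < 1 → (x t).Injective := fun t h0 h1 i j hij =>
    v.symm.injective (Fin.ext ((pow_right_injective₀ h0 h1.ne) hij))
  have hval : ∀ t w, aeval (x t) (denom n w) =
      (∏ i : Fin n, (x t (w i.castSucc) - x t (w i.succ))) * x t (w (Fin.last n)) := by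
    intro t w
    simp [denom]
  have hne : ∀ (w : Equiv.Perm (Fin (n + 1))) (i : Fin n), w i.castSucc ≠ w i.succ :=
    fun w i h => by simpa [Fin.ext_iff] using w.injective h
  have hrel : ∀ t, 0 < t → t < 1 →
      ∑ w, (c w : ℝ) * ∏ i : Fin n,
        (x t (w i.castSucc) / (x t (w i.castSucc) - x t (w i.succ))) = 0 := by
    intro t h0 h1
    have h := sum_mul_inv_map_eq_zero (K := Ffield n) (aeval (x t)).toRingHom
      (fun w => C (c w)) (denom n) (fun w => by
        change aeval (x t) (denom n w) ≠ 0
        rw [hval]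
        refine mul_ne_zero (Finset.prod_ne_zero_iff.2 fun i _ => sub_ne_zero.2 fun e => ?_)
          (hx0 t h0 _)
        exact hne w i (hinj t h0 h1 e)) (by
        rw [← hc]
        refine Finset.sum_congr rfl fun w _ => ?_
        rw [fperm, denom, map_mul, map_prod]
        congr 1
        exact map_ratCast ((algebraMap (Rpoly n) (Ffield n)).comp C) (c w))
    have h' := congrArg (fun s => (∏ j, x t j) * s) h
    rw [mul_zero] at h'
    rw [← h', Finset.mul_sum]
    refine Finset.sum_congr rfl fun w _ => ?_
    change _ = _ * (aeval (x t) (C (c w)) * (aeval (x t) (denom n w))⁻¹)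
    rw [hval, ← Equiv.prod_comp w, Fin.prod_univ_castSucc, Finset.prod_div_distrib, aeval_C]
    have := hx0 t h0 (w (Fin.last n))
    have h2 : ∏ i : Fin n, (x t (w i.castSucc) - x t (w i.succ)) ≠ 0 :=
      Finset.prod_ne_zero_iff.2 fun i _ => sub_ne_zero.2 fun e => hne w i (hinj t h0 h1 e)
    simp only [eq_ratCast]
    field_simp
  have hlim : Tendsto (fun t : ℝ => ∑ w, (c w : ℝ) * ∏ i : Fin n,
      (x t (w i.castSucc) / (x t (w i.castSucc) - x t (w i.succ)))) (𝓝[>] 0)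
      (𝓝 (∑ w, (c w : ℝ) * ∏ i : Fin n,
        if (v.symm (w i.castSucc) : ℕ) < v.symm (w i.succ) then 1 else 0)) :=
    tendsto_finsetSum _ fun w _ => (tendsto_finsetProd _ fun i _ =>
      tendsto_pow_div_pow_sub_pow fun e =>
        hne w i (v.symm.injective (Fin.ext e))).const_mul _
  have hzero := tendsto_nhds_unique hlim (tendsto_const_nhds.congr' (f₁ := fun _ => (0 : ℝ)) (by
    filter_upwards [Ioo_mem_nhdsGT (zero_lt_one (α := ℝ))] with t ht
    exact (hrel t ht.1 ht.2).symm))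
  rw [Finset.sum_eq_single v] at hzero
  · simpa using hzero
  · intro w _ hwv
    rw [mul_eq_zero, Finset.prod_eq_zero_iff]
    right
    by_contra! h
    have hmono : StrictMono (fun i => v.symm (w i)) := Fin.strictMono_iff_lt_succ.2 fun i => by
      have := h i (Finset.mem_univ i)
      by_contra hlt
      exact this (if_neg hlt)
    have hid : (fun i => v.symm (w i)) = id := hmono.range_inj strictMono_id |>.1 (by
      rw [Set.range_id, ← (w.trans v.symm).surjective.range_eq]
      rfl)
    exact hwv (Equiv.ext fun i => v.symm_apply_eq.1 (congrFun hid i))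
  · simp

end Independence

/-- the `r!` fractions `f_w` form a basis of `S_{A_r}`, so
`dim S_{A_r} = r!` (here `r = n + 1 ≥ 1`). -/
theorem fperm_basis_of_SAr (n : ℕ) :
    LinearIndependent ℚ (fperm n) ∧
    Submodule.span ℚ (Set.range (fperm n)) = SAr n ∧
    Module.finrank ℚ (SAr n) = Nat.factorial (n + 1) := by
  refine ⟨linearIndependent_fperm n, span_fperm_eq_SAr, ?_⟩
  rw [← span_fperm_eq_SAr, finrank_span_eq_card (linearIndependent_fperm n), Fintype.card_perm,
    Fintype.card_fin]

end
end

section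
/- Fix r ≥ 1. In ℝ^{r+1} with standard basis e_1,…,e_{r+1}, let E_r = {x ∈ ℝ^{r+1} : Σ_{i=1}^{r+1} x_i = 0}. For a permutation w of {1,…,r}, set ε(i) = 1 if w(i) < w(i+1) and ε(i) = −1 otherwise (for 1 ≤ i ≤ r−1), and let C_w^+ be the closed convex cone of nonnegative linear combinations of the r vectors ε(1)(e_{w(1)} − e_{w(2)}), …, ε(r−1)(e_{w(r−1)} − e_{w(r)}), e_{w(r)} − e_{r+1}. Then C_w^+ = {a ∈ E_r : for each 1 ≤ i ≤ r−1, Σ_{j=1}^i a_{w(j)} ≥ 0 if w(i) < w(i+1) and Σ_{j=1}^i a_{w(j)} ≤ 0 if w(i) > w(i+1); and Σ_{j=1}^r a_{w(j)} ≥ 0}. -/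
noncomputable section

/-- The generators of the simplicial cone `C_w^+` attached to a permutation `w` of
`{1, …, r}` (here `r = n + 1`, inside `ℝ^{r+1} = Fin (n+2) → ℝ`):
`ε(i)(e_{w(i)} - e_{w(i+1)})` for `1 ≤ i ≤ r - 1`, and `e_{w(r)} - e_{r+1}`. -/
def cwGen (n : ℕ) (w : Equiv.Perm (Fin (n + 1))) (i : Fin (n + 1)) : Fin (n + 2) → ℝ :=
  if h : (i : ℕ) < n then
    (if w (⟨i, h⟩ : Fin n).castSucc < w (⟨i, h⟩ : Fin n).succ then (1 : ℝ) else -1) •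
      (Pi.single ((w (⟨i, h⟩ : Fin n).castSucc).castSucc) (1 : ℝ) -
        Pi.single ((w (⟨i, h⟩ : Fin n).succ).castSucc) (1 : ℝ))
  else
    Pi.single ((w (Fin.last n)).castSucc) (1 : ℝ) - Pi.single (Fin.last (n + 1)) (1 : ℝ)

/-- The closed simplicial cone `C_w^+`: nonnegative linear combinations of the
generators above. -/
def cwPlus (n : ℕ) (w : Equiv.Perm (Fin (n + 1))) : Set (Fin (n + 2) → ℝ) :=
  {x | ∃ c : Fin (n + 1) → ℝ, (∀ i, 0 ≤ c i) ∧ x = ∑ i, c i • cwGen n w i}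

/-- The partial sum `∑_{j ≤ k} a_{w(j)}`, as a linear functional of `a`. -/
def partialSum (n : ℕ) (w : Equiv.Perm (Fin (n + 1))) (k : Fin (n + 1)) :
    (Fin (n + 2) → ℝ) →ₗ[ℝ] ℝ :=
  ∑ j ∈ Finset.Iic k, LinearMap.proj (w j).castSucc

theorem partialSum_apply (n : ℕ) (w : Equiv.Perm (Fin (n + 1))) (k : Fin (n + 1))
    (a : Fin (n + 2) → ℝ) :
    partialSum n w k a = ∑ j ∈ Finset.Iic k, a (w j).castSucc := by
  simp [partialSum]

theorem partialSum_single_castSucc (n : ℕ) (w : Equiv.Perm (Fin (n + 1)))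
    (k i : Fin (n + 1)) :
    partialSum n w k (Pi.single (w i).castSucc 1) = if i ≤ k then 1 else 0 := by
  simp [partialSum_apply, Pi.single_apply]

theorem partialSum_single_last (n : ℕ) (w : Equiv.Perm (Fin (n + 1))) (k : Fin (n + 1)) :
    partialSum n w k (Pi.single (Fin.last (n + 1)) 1) = 0 := by
  simp [partialSum_apply, Fin.castSucc_ne_last]

/-- The sign attached to the `i`-th generator of `C_w^+`; it is `1` for the last one. -/
def cwSign (n : ℕ) (w : Equiv.Perm (Fin (n + 1))) (i : Fin (n + 1)) : ℝ :=
  Fin.lastCases (motive := fun _ => ℝ) 1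
    (fun k : Fin n => if w k.castSucc < w k.succ then 1 else -1) i

@[simp]
theorem cwSign_last (n : ℕ) (w : Equiv.Perm (Fin (n + 1))) : cwSign n w (Fin.last n) = 1 := by
  simp [cwSign]

@[simp]
theorem cwSign_castSucc (n : ℕ) (w : Equiv.Perm (Fin (n + 1))) (k : Fin n) :
    cwSign n w k.castSucc = if w k.castSucc < w k.succ then 1 else -1 := by
  simp [cwSign]

theorem cwSign_mul_self (n : ℕ) (w : Equiv.Perm (Fin (n + 1))) (i : Fin (n + 1)) :
    cwSign n w i * cwSign n w i = 1 := by
  cases i using Fin.lastCases with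
  | last => simp
  | cast k => rw [cwSign_castSucc]; split_ifs <;> norm_num

theorem cwGen_last (n : ℕ) (w : Equiv.Perm (Fin (n + 1))) :
    cwGen n w (Fin.last n) =
      Pi.single (w (Fin.last n)).castSucc 1 - Pi.single (Fin.last (n + 1)) 1 := by
  simp [cwGen]

theorem cwGen_castSucc (n : ℕ) (w : Equiv.Perm (Fin (n + 1))) (k : Fin n) :
    cwGen n w k.castSucc = cwSign n w k.castSucc •
      (Pi.single (w k.castSucc).castSucc 1 - Pi.single (w k.succ).castSucc 1) := by
  rw [cwSign_castSucc]
  simp [cwGen]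

theorem sum_cwGen (n : ℕ) (w : Equiv.Perm (Fin (n + 1))) (i : Fin (n + 1)) :
    ∑ j, cwGen n w i j = 0 := by
  cases i using Fin.lastCases with
  | last => simp [cwGen_last]
  | cast k => simp [cwGen_castSucc, ← Finset.mul_sum, -cwSign_castSucc]

/-- Up to sign, the partial sums are dual to the generators of `C_w^+`. -/
theorem partialSum_cwGen (n : ℕ) (w : Equiv.Perm (Fin (n + 1))) (k i : Fin (n + 1)) :
    partialSum n w k (cwGen n w i) = if i = k then cwSign n w k else 0 := by
  cases i using Fin.lastCases with
  | last =>
    rw [cwGen_last, map_sub, partialSum_single_castSucc, partialSum_single_last, sub_zero]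
    by_cases h : Fin.last n = k
    · subst h; simp
    · simp [h, Fin.last_le_iff, Ne.symm h]
  | cast i =>
    rw [cwGen_castSucc, map_smul, map_sub, partialSum_single_castSucc,
      partialSum_single_castSucc]
    by_cases h : i.castSucc = k
    · subst h
      simp [-cwSign_castSucc]
    · have : i.castSucc ≤ k ↔ i.succ ≤ k := by
        rw [← Fin.castSucc_lt_iff_succ_le]
        exact ⟨fun hik => lt_of_le_of_ne hik h, le_of_lt⟩
      simp [h, this]

/-- A vector with zero coordinate sum is determined by its partial sums. -/
theorem eq_of_partialSum_eq (n : ℕ) (w : Equiv.Perm (Fin (n + 1))) {a b : Fin (n + 2) → ℝ}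
    (hs : ∑ i, a i = ∑ i, b i) (h : ∀ k, partialSum n w k a = partialSum n w k b) :
    a = b := by
  have key : ∀ k, a (w k).castSucc = b (w k).castSucc := by
    intro k
    induction k using WellFoundedLT.induction with
    | ind k ih =>
      have hk := h k
      rw [partialSum_apply, partialSum_apply, ← Finset.Iio_insert,
        Finset.sum_insert (by simp), Finset.sum_insert (by simp),
        Finset.sum_congr rfl fun j hj => ih j (Finset.mem_Iio.mp hj)] at hk
      exact add_right_cancel hk
  have hcast : ∀ i : Fin (n + 1), a i.castSucc = b i.castSucc := fun i => by
    simpa using key (w.symm i)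
  funext i
  cases i using Fin.lastCases with
  | last =>
    rw [Fin.sum_univ_castSucc, Fin.sum_univ_castSucc b,
      Finset.sum_congr rfl fun i _ => hcast i] at hs
    exact add_left_cancel hs
  | cast i => exact hcast i

theorem partialSum_sum_smul_cwGen (n : ℕ) (w : Equiv.Perm (Fin (n + 1)))
    (c : Fin (n + 1) → ℝ) (k : Fin (n + 1)) :
    partialSum n w k (∑ i, c i • cwGen n w i) = c k * cwSign n w k := by
  simp [partialSum_cwGen]

theorem sum_sum_smul_cwGen (n : ℕ) (w : Equiv.Perm (Fin (n + 1))) (c : Fin (n + 1) → ℝ) :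
    ∑ j, (∑ i, c i • cwGen n w i) j = 0 := by
  simp only [Finset.sum_apply, Pi.smul_apply, smul_eq_mul]
  rw [Finset.sum_comm]
  simp [← Finset.mul_sum, sum_cwGen]

theorem mem_cwPlus_iff (n : ℕ) (w : Equiv.Perm (Fin (n + 1))) (a : Fin (n + 2) → ℝ) :
    a ∈ cwPlus n w ↔
      ∑ i, a i = 0 ∧ ∀ k, 0 ≤ cwSign n w k * partialSum n w k a := by
  constructor
  · rintro ⟨c, hc, rfl⟩
    refine ⟨sum_sum_smul_cwGen n w c, fun k => ?_⟩
    rw [partialSum_sum_smul_cwGen, mul_left_comm, cwSign_mul_self, mul_one]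
    exact hc k
  · rintro ⟨hs, h⟩
    refine ⟨fun k => cwSign n w k * partialSum n w k a, h, ?_⟩
    refine eq_of_partialSum_eq n w (hs.trans (sum_sum_smul_cwGen n w _).symm) fun k => ?_
    rw [partialSum_sum_smul_cwGen, mul_right_comm, cwSign_mul_self, one_mul]

/-- description of `C_w^+` by the inequalities on the partial sums
`Σ_{j=1}^i a_{w(j)}`. -/
theorem cwPlus_eq_partial_sum_inequalities (n : ℕ) (w : Equiv.Perm (Fin (n + 1))) :
    cwPlus n w =
      {a : Fin (n + 2) → ℝ | (∑ i, a i = 0) ∧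
        (∀ k : Fin n,
          (w k.castSucc < w k.succ →
            0 ≤ ∑ j ∈ Finset.Iic (k.castSucc : Fin (n + 1)), a ((w j).castSucc)) ∧
          (w k.succ < w k.castSucc →
            (∑ j ∈ Finset.Iic (k.castSucc : Fin (n + 1)), a ((w j).castSucc)) ≤ 0)) ∧
        0 ≤ ∑ j : Fin (n + 1), a ((w j).castSucc)} := by
  ext a
  rw [mem_cwPlus_iff, Set.mem_ofPred_eq, Fin.forall_fin_succ', cwSign_last, one_mul,
    partialSum_apply n w (Fin.last n), ← Fin.top_eq_last, Finset.Iic_top]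
  refine and_congr_right fun _ => and_congr_left fun _ => forall_congr' fun k => ?_
  have hne : w k.castSucc ≠ w k.succ := w.injective.ne k.castSucc_lt_succ.ne
  rw [cwSign_castSucc, partialSum_apply]
  rcases hne.lt_or_gt with h | h
  · simp [h, h.not_gt]
  · simp [h, h.not_gt]

end
end

section
/- Fix r ≥ 1 and let a ∈ E_r = {x ∈ ℝ^{r+1} : Σ x_i = 0} satisfy a_i > 0 for all 1 ≤ i ≤ r (so a_{r+1} = −Σ_{i=1}^r a_i < 0). Then for a permutation w of {1,…,r}, a belongs to the cone C_w^+ if and only if w is the identity permutation. -/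
noncomputable section

/-- Summing the coordinates `w 0, …, w k` of the `i`-th generator gives `0` unless `i = k`. -/
theorem sum_Iic_cwGen_of_ne (n : ℕ) (w : Equiv.Perm (Fin (n + 1))) (k i : Fin (n + 1))
    (hik : i ≠ k) : ∑ j ∈ Finset.Iic k, cwGen n w i (w j).castSucc = 0 := by
  have hne := Fin.val_ne_of_ne hik
  by_cases h : (i : ℕ) < n
  · have h1 : i ≤ k ↔ (⟨i + 1, by omega⟩ : Fin (n + 1)) ≤ k := by
      simp only [Fin.le_def]
      omega
    simp [cwGen, h, Pi.single_apply, Finset.sum_sub_distrib, ← h1]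
  · have h1 : k ≠ Fin.last n := by
      rw [ne_eq, Fin.ext_iff, Fin.val_last]
      omega
    simp [cwGen, h, Pi.single_apply, h1]

/-- At a descent `k` of `w`, summing the coordinates `w 0, …, w k` of the `k`-th generator
gives `-1`. -/
theorem sum_Iic_cwGen_of_descent (n : ℕ) (w : Equiv.Perm (Fin (n + 1))) (k : Fin n)
    (hk : ¬ w k.castSucc < w k.succ) :
    ∑ j ∈ Finset.Iic k.castSucc, cwGen n w k.castSucc (w j).castSucc = -1 := by
  have h1 : ¬ k.succ ≤ k.castSucc := by simp [Fin.le_def]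
  simp [cwGen, hk, Pi.single_apply, Finset.sum_sub_distrib, h1]

/-- A permutation `w` whose cone contains a vector with positive first `n + 1` coordinates is the
identity. -/
theorem eq_one_of_mem_cwPlus (n : ℕ) (a : Fin (n + 2) → ℝ)
    (hpos : ∀ i : Fin (n + 1), 0 < a i.castSucc) (w : Equiv.Perm (Fin (n + 1)))
    (ha : a ∈ cwPlus n w) : w = 1 := by
  obtain ⟨c, hc, rfl⟩ := ha
  have hmono : StrictMono w := by
    rw [Fin.strictMono_iff_lt_succ]
    intro k
    by_contra hk
    have hsum := Finset.sum_pos (s := Finset.Iic k.castSucc)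
      (fun j _ => hpos (w j)) ⟨k.castSucc, by simp⟩
    simp only [Finset.sum_apply, Pi.smul_apply, smul_eq_mul] at hsum
    rw [Finset.sum_comm] at hsum
    simp only [← Finset.mul_sum] at hsum
    rw [Finset.sum_eq_single k.castSucc
      (fun i _ hi => by rw [sum_Iic_cwGen_of_ne n w _ i hi, mul_zero]) (by simp),
      sum_Iic_cwGen_of_descent n w k hk] at hsum
    linarith [hc k.castSucc]
  have hid : (hmono.orderIsoOfSurjective w w.surjective) = OrderIso.refl _ :=
    Subsingleton.elim _ _
  ext1 i
  exact DFunLike.congr_fun hid i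

theorem cwGen_one (n : ℕ) (i : Fin (n + 1)) :
    cwGen n 1 i = Pi.single i.castSucc (1 : ℝ) - Pi.single i.succ (1 : ℝ) := by
  unfold cwGen
  split_ifs with h h'
  · rw [one_smul]; rfl
  · exact absurd (by simp [Fin.lt_def]) h'
  · obtain rfl : i = Fin.last n := by ext; simp only [Fin.val_last]; omega
    rfl

theorem mem_cwPlus_one (n : ℕ) (a : Fin (n + 2) → ℝ)
    (hE : ∑ i, a i = 0) (hpos : ∀ i : Fin (n + 1), 0 ≤ a i.castSucc) : a ∈ cwPlus n 1 := by
  refine ⟨fun i => ∑ j ∈ Finset.Iic i, a j.castSucc,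
    fun i => Finset.sum_nonneg fun j _ => hpos j, ?_⟩
  ext k
  simp only [cwGen_one, Finset.sum_apply, Pi.smul_apply, Pi.sub_apply, smul_eq_mul, mul_sub,
    Finset.sum_sub_distrib, Pi.single_apply, mul_ite, mul_one, mul_zero]
  refine Fin.cases ?_ (fun k => ?_) k
  · have h0 (i : Fin (n + 1)) : (0 : Fin (n + 2)) = i.castSucc ↔ 0 = i := by
      simp [Fin.ext_iff]
    have h1 (i : Fin (n + 1)) : (0 : Fin (n + 2)) ≠ i.succ := (Fin.succ_ne_zero i).symm
    have h2 : Finset.Iic (0 : Fin (n + 1)) = {0} := by ext; simp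
    simp [h0, h1, h2]
  · simp only [Fin.succ_inj, Finset.sum_ite_eq, Finset.mem_univ, if_true]
    refine Fin.lastCases ?_ (fun k => ?_) k
    · have h2 : Finset.Iic (Fin.last n) = Finset.univ := by ext; simp [Fin.le_last]
      have h1 (i : Fin (n + 1)) : Fin.last (n + 1) ≠ i.castSucc := (Fin.castSucc_ne_last i).symm
      rw [Fin.sum_univ_castSucc] at hE
      simp only [Fin.succ_last, h1, h2, if_false, Finset.sum_const_zero]
      linarith
    · have h2 : Finset.Iic k.succ = insert k.succ (Finset.Iic k.castSucc) := by
        ext j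
        simp only [Finset.mem_Iic, Finset.mem_insert, Fin.le_def, Fin.ext_iff, Fin.val_succ,
          Fin.val_castSucc]
        omega
      have h3 : k.succ ∉ Finset.Iic k.castSucc := by simp [Fin.le_def]
      simp only [Fin.succ_castSucc, Fin.castSucc_inj, Finset.sum_ite_eq, Finset.mem_univ,
        if_true, h2, Finset.sum_insert h3]
      ring

/-- if `a ∈ E_r` has `a_i > 0` for all `i ≤ r`, then `a ∈ C_w^+` iff `w`
is the identity permutation. -/
theorem mem_cwPlus_iff_id_of_pos (n : ℕ) (a : Fin (n + 2) → ℝ)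
    (hE : ∑ i, a i = 0) (hpos : ∀ i : Fin (n + 1), 0 < a i.castSucc)
    (w : Equiv.Perm (Fin (n + 1))) :
    a ∈ cwPlus n w ↔ w = 1 := by
  refine ⟨eq_one_of_mem_cwPlus n a hpos w, ?_⟩
  rintro rfl
  exact mem_cwPlus_one n a hE fun i => (hpos i).le

end
end

section
/- Assume additionally that the only x ∈ ℝ^N with x ≥ 0 and Σ_i x_i φ_i = 0 is x = 0. Let I be a combinatorial chamber. Then there exists a polynomial function P : ℝ^r → ℝ such that for every a ∈ F(I), the (N−r)-dimensional Hausdorff measure of the polytope P(Φ,a) = {x ∈ ℝ_{≥0}^N : Σ_{i=1}^N x_i φ_i = a} equals P(a). -/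
noncomputable section

/-- The closed convex cone of nonnegative linear combinations of `{φ i : i ∈ σ}`. -/
def coneOf {N r : ℕ} (φ : Fin N → (Fin r → ℝ)) (σ : Finset (Fin N)) : Set (Fin r → ℝ) :=
  {y | ∃ c : Fin N → ℝ, (∀ i, 0 ≤ c i) ∧ (∀ i, i ∉ σ → c i = 0) ∧ y = ∑ i, c i • φ i}

/-- `σ` is a basic subset: `r` indices whose vectors are linearly independent. -/
def IsBasic {N r : ℕ} (φ : Fin N → (Fin r → ℝ)) (σ : Finset (Fin N)) : Prop :=
  σ.card = r ∧ LinearIndependent ℝ (fun i : {i // i ∈ σ} => φ i)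

/-- `F(I) = ⋂_{σ ∈ I} C(σ)`. -/
def Fcone {N r : ℕ} (φ : Fin N → (Fin r → ℝ)) (I : Set (Finset (Fin N))) :
    Set (Fin r → ℝ) :=
  ⋂ σ ∈ I, coneOf φ σ

/-- `I` is feasible when `F(I)` has nonempty interior. -/
def IsFeasible {N r : ℕ} (φ : Fin N → (Fin r → ℝ)) (I : Set (Finset (Fin N))) : Prop :=
  (interior (Fcone φ I)).Nonempty

/-- A combinatorial chamber: a maximal feasible set of basic subsets. -/
def IsChamber {N r : ℕ} (φ : Fin N → (Fin r → ℝ)) (I : Set (Finset (Fin N))) : Prop :=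
  (∀ σ ∈ I, IsBasic φ σ) ∧ IsFeasible φ I ∧
  ∀ J : Set (Finset (Fin N)), I ⊆ J → (∀ σ ∈ J, IsBasic φ σ) → IsFeasible φ J → J = I

/-- A wall: an `(r-1)`-dimensional subspace spanned by `r - 1` linearly independent
vectors from `Δ⁺`. -/
def IsWall {N r : ℕ} (φ : Fin N → (Fin r → ℝ)) (W : Submodule ℝ (Fin r → ℝ)) : Prop :=
  ∃ s : Finset (Fin N), s.card = r - 1 ∧
    LinearIndependent ℝ (fun i : {i // i ∈ s} => φ i) ∧
    W = Submodule.span ℝ (φ '' (s : Set (Fin N)))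

open MeasureTheory Filter Topology

/-- The linear map `x ↦ ∑ i, x i • φ i`. -/
abbrev lcMap {N r : ℕ} (φ : Fin N → (Fin r → ℝ)) : (Fin N → ℝ) →ₗ[ℝ] (Fin r → ℝ) :=
  Fintype.linearCombination ℝ φ

/-- The linear relations among the `φ i` supported on `S`. -/
def relSpace {N r : ℕ} (φ : Fin N → (Fin r → ℝ)) (S : Finset (Fin N)) :
    Submodule ℝ (Fin N → ℝ) where
  carrier := {x | (∀ i, i ∉ S → x i = 0) ∧ lcMap φ x = 0}
  add_mem' := by
    rintro x y ⟨hx, hx'⟩ ⟨hy, hy'⟩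
    exact ⟨fun i hi => by simp [hx i hi, hy i hi], by simp only [map_add, hx', hy', add_zero]⟩
  zero_mem' := ⟨fun _ _ => rfl, map_zero _⟩
  smul_mem' := by
    rintro c x ⟨hx, hx'⟩
    exact ⟨fun i hi => by simp [hx i hi], by simp only [map_smul, hx', smul_zero]⟩

lemma mem_relSpace {N r : ℕ} {φ : Fin N → (Fin r → ℝ)} {S : Finset (Fin N)} {x : Fin N → ℝ} :
    x ∈ relSpace φ S ↔ (∀ i, i ∉ S → x i = 0) ∧ lcMap φ x = 0 := Iff.rfl

/-- The vectors `φ i`, `i ∈ S`, span the whole space. -/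
def SpansOn {N r : ℕ} (φ : Fin N → (Fin r → ℝ)) (S : Finset (Fin N)) : Prop :=
  ∀ a, ∃ x : Fin N → ℝ, (∀ i, i ∉ S → x i = 0) ∧ lcMap φ x = a

/-- The polytope `{x ≥ 0 : ∑ i, x i • φ i = a}` with coordinates outside `S` equal to `0`. -/
def polytopeOn {N r : ℕ} (φ : Fin N → (Fin r → ℝ)) (S : Finset (Fin N)) (a : Fin r → ℝ) :
    Set (Fin N → ℝ) :=
  {x | (∀ i, 0 ≤ x i) ∧ (∀ i, i ∉ S → x i = 0) ∧ lcMap φ x = a}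

/-- Hausdorff measure of `polytopeOn φ S a` in the dimension of its ambient affine space. -/
def volOn {N r : ℕ} (φ : Fin N → (Fin r → ℝ)) (S : Finset (Fin N)) (a : Fin r → ℝ) : ENNReal :=
  Measure.hausdorffMeasure (Module.finrank ℝ (relSpace φ S) : ℝ) (polytopeOn φ S a)

/-- Hausdorff measure on the space of relations supported on `S`, an additive Haar measure. -/
abbrev relMeasure {N r : ℕ} (φ : Fin N → (Fin r → ℝ)) (S : Finset (Fin N)) :
    Measure (relSpace φ S) :=
  Measure.hausdorffMeasure (Module.finrank ℝ (relSpace φ S) : ℝ)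

section

variable {N r : ℕ} {φ : Fin N → (Fin r → ℝ)} {S : Finset (Fin N)}

lemma mem_coneOf {y : Fin r → ℝ} : y ∈ coneOf φ S ↔ (polytopeOn φ S y).Nonempty := by
  constructor
  · rintro ⟨c, h0, h1, rfl⟩
    exact ⟨c, h0, h1, rfl⟩
  · rintro ⟨c, h0, h1, rfl⟩
    exact ⟨c, h0, h1, rfl⟩

lemma volOn_eq (x : Fin N → ℝ) (hx : ∀ i, i ∉ S → x i = 0) :
    volOn φ S (lcMap φ x) = relMeasure φ S {k | ∀ i, 0 ≤ k.1 i + x i} := by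
  have h1 : polytopeOn φ S (lcMap φ x) =
      (fun k : relSpace φ S => x +ᵥ k.1) '' {k | ∀ i, 0 ≤ k.1 i + x i} := by
    ext y
    constructor
    · rintro ⟨h0, h1, h2⟩
      refine ⟨⟨y - x, fun i hi => by simp [h1 i hi, hx i hi], ?_⟩, fun i => by simpa using h0 i, ?_⟩
      · rw [map_sub, h2, sub_self]
      · simp
    · rintro ⟨k, hk, rfl⟩
      refine ⟨fun i => ?_, fun i hi => ?_, ?_⟩
      · simpa [add_comm] using hk i
      · simp [hx i hi, k.2.1 i hi]
      · simp only [vadd_eq_add]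
        rw [map_add, k.2.2, add_zero]
  rw [volOn, h1]
  exact Isometry.hausdorffMeasure_image ((isometry_vadd _ x).comp isometry_subtype_coe)
    (Or.inl (Nat.cast_nonneg _)) _

lemma volOn_eq_zero {a : Fin r → ℝ} (ha : a ∉ coneOf φ S) : volOn φ S a = 0 := by
  rw [mem_coneOf, Set.not_nonempty_iff_eq_empty] at ha
  rw [volOn, ha, measure_empty]

lemma exists_norm_le_lcMap
    (hpointed : ∀ x : Fin N → ℝ, (∀ i, 0 ≤ x i) → (∑ i, x i • φ i) = 0 → x = 0) :
    ∃ C : ℝ, ∀ x : Fin N → ℝ, (∀ i, 0 ≤ x i) → ‖x‖ ≤ C * ‖lcMap φ x‖ := by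
  have hcont : Continuous (lcMap φ) := LinearMap.continuous_of_finiteDimensional _
  have hK : IsCompact (Metric.sphere (0 : Fin N → ℝ) 1 ∩ {x | ∀ i, 0 ≤ x i}) := by
    apply (isCompact_sphere _ _).inter_right
    simp only [Set.ofPred_forall]
    exact isClosed_iInter fun i => isClosed_le continuous_const (continuous_apply i)
  rcases Set.eq_empty_or_nonempty (Metric.sphere (0 : Fin N → ℝ) 1 ∩ {x | ∀ i, 0 ≤ x i})
    with hem | hne
  · refine ⟨0, fun x hx => ?_⟩
    by_contra hlt
    have hpos : 0 < ‖x‖ := by simpa using hlt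
    have : ‖x‖⁻¹ • x ∈ Metric.sphere (0 : Fin N → ℝ) 1 ∩ {x | ∀ i, 0 ≤ x i} := by
      refine ⟨by simp [norm_smul, hpos.ne'], fun i => ?_⟩
      exact mul_nonneg (inv_nonneg.2 hpos.le) (hx i)
    rw [hem] at this
    exact this
  · obtain ⟨z, hz, hmin⟩ := hK.exists_isMinOn hne (hcont.norm.continuousOn)
    have hzpos : 0 < ‖lcMap φ z‖ := by
      rw [norm_pos_iff]
      intro h0
      have := hpointed z hz.2 h0
      have h1 := hz.1
      simp [this] at h1
    refine ⟨‖lcMap φ z‖⁻¹, fun x hx => ?_⟩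
    rcases eq_or_ne x 0 with rfl | hx0
    · simp
    have hpos : 0 < ‖x‖ := norm_pos_iff.2 hx0
    have hmem : ‖x‖⁻¹ • x ∈ Metric.sphere (0 : Fin N → ℝ) 1 ∩ {x | ∀ i, 0 ≤ x i} := by
      refine ⟨by simp [norm_smul, hpos.ne'], fun i => ?_⟩
      exact mul_nonneg (inv_nonneg.2 hpos.le) (hx i)
    have := isMinOn_iff.1 hmin _ hmem
    rw [map_smul, norm_smul, norm_inv, norm_norm, inv_mul_eq_div, le_div_iff₀ hpos] at this
    rw [inv_mul_eq_div, le_div_iff₀ hzpos]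
    linarith

lemma isClosed_shifted (x : Fin N → ℝ) :
    IsClosed {k : relSpace φ S | ∀ i, 0 ≤ k.1 i + x i} := by
  simp only [Set.ofPred_forall]
  exact isClosed_iInter fun i => isClosed_le continuous_const
    (((continuous_apply i).comp continuous_subtype_val).add continuous_const)

lemma relMeasure_shifted_lt_top
    (hpointed : ∀ x : Fin N → ℝ, (∀ i, 0 ≤ x i) → (∑ i, x i • φ i) = 0 → x = 0)
    (x : Fin N → ℝ) : relMeasure φ S {k | ∀ i, 0 ≤ k.1 i + x i} < ⊤ := by
  obtain ⟨C, hC⟩ := exists_norm_le_lcMap hpointed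
  have : (relMeasure φ S).IsAddHaarMeasure := isAddHaarMeasure_hausdorffMeasure
  apply Bornology.IsBounded.measure_lt_top
  apply (isBounded_iff_forall_norm_le).2
  refine ⟨C * ‖lcMap φ x‖ + ‖x‖, fun k hk => ?_⟩
  have h1 := hC (k.1 + x) hk
  rw [map_add, k.2.2, zero_add] at h1
  have h2 := norm_sub_le (k.1 + x) x
  rw [add_sub_cancel_right] at h2
  have : ‖k‖ = ‖k.1‖ := rfl
  linarith

lemma volOn_lt_top (hS : SpansOn φ S)
    (hpointed : ∀ x : Fin N → ℝ, (∀ i, 0 ≤ x i) → (∑ i, x i • φ i) = 0 → x = 0)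
    (a : Fin r → ℝ) : volOn φ S a < ⊤ := by
  obtain ⟨x, hx, rfl⟩ := hS a
  rw [volOn_eq x hx]
  exact relMeasure_shifted_lt_top hpointed x

lemma SpansOn.erase (hS : SpansOn φ S) {g : Fin N → ℝ} (hg : g ∈ relSpace φ S) {i : Fin N}
    (hi : g i ≠ 0) : SpansOn φ (S.erase i) := by
  intro a
  obtain ⟨x, hx, rfl⟩ := hS a
  refine ⟨x - (x i / g i) • g, fun j hj => ?_, ?_⟩
  · rw [Finset.mem_erase, not_and_or, not_not] at hj
    rcases hj with rfl | hj
    · simp [hi]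
    · simp [hx j hj, hg.1 j hj]
  · rw [map_sub, map_smul, hg.2, smul_zero, sub_zero]

lemma isBasic_of_relSpace_eq_bot (hS : SpansOn φ S) (h : relSpace φ S = ⊥) : IsBasic φ S := by
  have hsum : ∀ x : Fin N → ℝ, (∀ i, i ∉ S → x i = 0) →
      lcMap φ x = ∑ i : {i // i ∈ S}, x i • φ i := by
    intro x hx
    rw [Fintype.linearCombination_apply,
      ← Finset.sum_subset (Finset.subset_univ S) (fun i _ hi => by simp [hx i hi])]
    exact (Finset.sum_coe_sort S (fun i => x i • φ i)).symm
  have hli : LinearIndependent ℝ (fun i : {i // i ∈ S} => φ i) := by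
    rw [Fintype.linearIndependent_iff]
    intro g hg i
    have hmem : (fun j => if hj : j ∈ S then g ⟨j, hj⟩ else 0) ∈ relSpace φ S := by
      refine ⟨fun j hj => by simp [hj], ?_⟩
      rw [hsum _ (fun j hj => by simp [hj])]
      simpa using hg
    rw [h, Submodule.mem_bot] at hmem
    simpa using congrFun hmem i.1
  refine ⟨?_, hli⟩
  have hsp : ⊤ ≤ Submodule.span ℝ (Set.range (fun i : {i // i ∈ S} => φ i)) := by
    intro a _
    obtain ⟨x, hx, rfl⟩ := hS a
    rw [Submodule.mem_span_range_iff_exists_fun]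
    exact ⟨fun i => x i, (hsum x hx).symm⟩
  have := Module.finrank_eq_card_basis (Module.Basis.mk hli hsp)
  simpa using this.symm

/-- Conic Carathéodory theorem. -/
lemma exists_isBasic_subset
    (hpointed : ∀ x : Fin N → ℝ, (∀ i, 0 ≤ x i) → (∑ i, x i • φ i) = 0 → x = 0)
    (hS : SpansOn φ S) {a : Fin r → ℝ} (ha : a ∈ coneOf φ S) :
    ∃ σ ⊆ S, IsBasic φ σ ∧ a ∈ coneOf φ σ := by
  induction S using Finset.strongInduction with
  | H S ih =>
    by_cases hbot : relSpace φ S = ⊥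
    · exact ⟨S, subset_rfl, isBasic_of_relSpace_eq_bot hS hbot, ha⟩
    obtain ⟨g, hg, i₀, hi₀⟩ : ∃ g ∈ relSpace φ S, ∃ i, 0 < g i := by
      obtain ⟨g, hg, hg0⟩ := Submodule.exists_mem_ne_zero_of_ne_bot hbot
      by_contra! hcon
      have := hpointed (-g) (fun i => neg_nonneg.2 (hcon g hg i)) (neg_mem hg).2
      exact hg0 (neg_eq_zero.1 this)
    obtain ⟨x, hx0, hxS, rfl⟩ := mem_coneOf.1 ha
    obtain ⟨i, hi, hmin⟩ := Finset.exists_min_image (Finset.univ.filter fun i => 0 < g i)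
      (fun i => x i / g i) ⟨i₀, by simpa using hi₀⟩
    simp only [Finset.mem_filter, Finset.mem_univ, true_and] at hi hmin
    have hiS : i ∈ S := by
      by_contra h
      exact hi.ne' (hg.1 i h)
    obtain ⟨σ, hσ, hb, hm⟩ := ih (S.erase i) (Finset.erase_ssubset hiS) (hS.erase hg hi.ne') (by
      rw [mem_coneOf]
      refine ⟨x - (x i / g i) • g, fun j => ?_, fun j hj => ?_, ?_⟩
      · simp only [Pi.sub_apply, Pi.smul_apply, smul_eq_mul, sub_nonneg]
        rcases lt_or_ge 0 (g j) with hj | hj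
        · exact (le_div_iff₀ hj).1 (hmin j hj)
        · exact (mul_nonpos_of_nonneg_of_nonpos (div_nonneg (hx0 i) hi.le) hj).trans (hx0 j)
      · rw [Finset.mem_erase, not_and_or, not_not] at hj
        rcases hj with rfl | hj
        · simp [hi.ne']
        · simp [hxS j hj, hg.1 j hj]
      · rw [map_sub, map_smul, hg.2, smul_zero, sub_zero])
    exact ⟨σ, hσ.trans (Finset.erase_subset _ _), hb, hm⟩

lemma coneOf_mono {σ τ : Finset (Fin N)} (h : σ ⊆ τ) : coneOf φ σ ⊆ coneOf φ τ := by
  rintro y ⟨c, h0, h1, rfl⟩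
  exact ⟨c, h0, fun i hi => h1 i (fun h' => hi (h h')), rfl⟩

lemma coneOf_add {y z : Fin r → ℝ} (hy : y ∈ coneOf φ S) (hz : z ∈ coneOf φ S) :
    y + z ∈ coneOf φ S := by
  rw [mem_coneOf] at *
  obtain ⟨c, h0, h1, rfl⟩ := hy
  obtain ⟨d, h2, h3, rfl⟩ := hz
  exact ⟨c + d, fun i => add_nonneg (h0 i) (h2 i), fun i hi => by simp [h1 i hi, h3 i hi],
    map_add _ _ _⟩

lemma coneOf_smul {y : Fin r → ℝ} (hy : y ∈ coneOf φ S) {t : ℝ} (ht : 0 ≤ t) :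
    t • y ∈ coneOf φ S := by
  rw [mem_coneOf] at *
  obtain ⟨c, h0, h1, rfl⟩ := hy
  exact ⟨t • c, fun i => mul_nonneg ht (h0 i), fun i hi => by simp [h1 i hi], map_smul _ _ _⟩

lemma convex_coneOf : Convex ℝ (coneOf φ S) := fun _ hx _ hy _ _ ha hb _ =>
  coneOf_add (coneOf_smul hx ha) (coneOf_smul hy hb)

lemma Fcone_add {I : Set (Finset (Fin N))} {y z : Fin r → ℝ} (hy : y ∈ Fcone φ I)
    (hz : z ∈ Fcone φ I) : y + z ∈ Fcone φ I := by
  simp only [Fcone, Set.mem_iInter] at *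
  exact fun σ hσ => coneOf_add (hy σ hσ) (hz σ hσ)

lemma Fcone_smul {I : Set (Finset (Fin N))} {y : Fin r → ℝ} (hy : y ∈ Fcone φ I) {t : ℝ}
    (ht : 0 ≤ t) : t • y ∈ Fcone φ I := by
  simp only [Fcone, Set.mem_iInter] at *
  exact fun σ hσ => coneOf_smul (hy σ hσ) ht

lemma convex_Fcone {I : Set (Finset (Fin N))} : Convex ℝ (Fcone φ I) :=
  fun _ hx _ hy _ _ ha hb _ => Fcone_add (Fcone_smul hx ha) (Fcone_smul hy hb)

lemma add_smul_mem_interior_Fcone {I : Set (Finset (Fin N))} {a u : Fin r → ℝ}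
    (ha : a ∈ Fcone φ I) (hu : u ∈ interior (Fcone φ I)) {t : ℝ} (ht : 0 < t) :
    a + t • u ∈ interior (Fcone φ I) := by
  have hopen : IsOpenMap (fun v : Fin r → ℝ => a + t • v) :=
    (isOpenMap_add_left a).comp (isOpenMap_smul₀ ht.ne')
  refine interior_maximal ?_ (hopen _ isOpen_interior) ⟨u, hu, rfl⟩
  rintro _ ⟨v, hv, rfl⟩
  exact Fcone_add ha (Fcone_smul (interior_subset hv) ht.le)

lemma IsBasic.interior_coneOf_nonempty (h : IsBasic φ S) : (interior (coneOf φ S)).Nonempty := by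
  have hsp := h.2.span_eq_top_of_card_eq_finrank' (by simp [h.1])
  set L : ({i // i ∈ S} → ℝ) →ₗ[ℝ] (Fin r → ℝ) :=
    Fintype.linearCombination ℝ (fun i : {i // i ∈ S} => φ i) with hL
  have hsurj : Function.Surjective L := by
    rw [← LinearMap.range_eq_top, hL, Fintype.range_linearCombination, hsp]
  have hopen := L.isOpenMap_of_finiteDimensional hsurj
  have hpos : IsOpen {c : {i // i ∈ S} → ℝ | ∀ i, 0 < c i} := by
    simp only [Set.ofPred_forall]
    exact isOpen_iInter_of_finite fun i => isOpen_lt continuous_const (continuous_apply i)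
  refine ⟨L 1, interior_maximal ?_ (hopen _ hpos) ⟨1, fun i => one_pos, rfl⟩⟩
  rintro _ ⟨c, hc, rfl⟩
  refine ⟨fun j => if hj : j ∈ S then c ⟨j, hj⟩ else 0, fun j => ?_, fun j hj => by simp [hj], ?_⟩
  · dsimp only
    split_ifs with hj
    · exact (hc _).le
    · exact le_rfl
  · rw [← Finset.sum_subset (Finset.subset_univ S) (fun i _ hi => by simp [hi]),
      ← Finset.sum_coe_sort, hL, Fintype.linearCombination_apply]
    simp

lemma IsChamber.mem_of_inter_nonempty {I : Set (Finset (Fin N))} (hI : IsChamber φ I)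
    (hS : IsBasic φ S) (h : (interior (Fcone φ I) ∩ coneOf φ S).Nonempty) : S ∈ I := by
  obtain ⟨y, hyI, hyS⟩ := h
  have hcl : y ∈ closure (interior (coneOf φ S)) := by
    rw [convex_coneOf.closure_interior_eq_closure_of_nonempty_interior hS.interior_coneOf_nonempty]
    exact subset_closure hyS
  have hne := mem_closure_iff.1 hcl _ isOpen_interior hyI
  have := hI.2.2 (insert S I) (Set.subset_insert _ _)
    (by
      rintro σ (rfl | hσ)
      · exact hS
      · exact hI.1 σ hσ)
    (by
      rw [IsFeasible, Fcone, Set.biInter_insert, interior_inter, Set.inter_comm]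
      exact hne)
  exact this ▸ Set.mem_insert S I

lemma IsChamber.subset_coneOf {I : Set (Finset (Fin N))} (hI : IsChamber φ I)
    (hpointed : ∀ x : Fin N → ℝ, (∀ i, 0 ≤ x i) → (∑ i, x i • φ i) = 0 → x = 0)
    (hS : SpansOn φ S) (h : (interior (Fcone φ I) ∩ coneOf φ S).Nonempty) :
    Fcone φ I ⊆ coneOf φ S := by
  obtain ⟨y, hyI, hyS⟩ := h
  obtain ⟨σ, hσ, hb, hy⟩ := exists_isBasic_subset hpointed hS hyS
  exact (Set.biInter_subset_of_mem (hI.mem_of_inter_nonempty hb ⟨y, hyI, hy⟩)).trans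
    (coneOf_mono hσ)


/-- Slicing along the coordinate `i`. -/
lemma exists_volOn_add_smul_eq_lintegral {i : Fin N} (hiS : i ∈ S)
    (hS : SpansOn φ (S.erase i)) :
    ∃ c : NNReal, ∀ (a : Fin r → ℝ) (t : ℝ),
      volOn φ S (a + t • φ i) = c * ∫⁻ s in Set.Iic t, volOn φ (S.erase i) (a + s • φ i) := by
  have hsingle : ∀ s : ℝ, lcMap φ (Pi.single i s) = s • φ i := fun s => by
    rw [Fintype.linearCombination_apply_single]
  obtain ⟨w, hw, hwi⟩ : ∃ w ∈ relSpace φ S, w i = -1 := by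
    obtain ⟨x, hx, hxi⟩ := hS (φ i)
    refine ⟨x - Pi.single i 1, ⟨fun j hj => ?_, ?_⟩, ?_⟩
    · have hji : j ≠ i := fun h => hj (h ▸ hiS)
      simp [hx j (fun h => hj (Finset.mem_of_mem_erase h)), hji]
    · rw [map_sub, hxi, hsingle, one_smul, sub_self]
    · simp [hx i]
  have hle : ∀ k ∈ relSpace φ (S.erase i), k ∈ relSpace φ S := fun k hk =>
    ⟨fun j hj => hk.1 j (fun h => hj (Finset.mem_of_mem_erase h)), hk.2⟩
  let e : (relSpace φ (S.erase i) × ℝ) ≃ₗ[ℝ] relSpace φ S :=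
    { toFun := fun p => ⟨p.1.1 + p.2 • w, add_mem (hle _ p.1.2) (Submodule.smul_mem _ _ hw)⟩
      map_add' := fun p q => by
        ext j
        simp
        ring
      map_smul' := fun c p => by
        ext j
        simp
        ring
      invFun := fun k => (⟨k.1 + k.1 i • w, by
        refine ⟨fun j hj => ?_, ?_⟩
        · rw [Finset.mem_erase, not_and_or, not_not] at hj
          rcases hj with rfl | hj
          · simp [hwi]
          · simp [k.2.1 j hj, hw.1 j hj]
        · rw [map_add, map_smul, k.2.2, hw.2, smul_zero, add_zero]⟩, - k.1 i)
      left_inv := fun p => by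
        have := p.1.2.1 i (by simp)
        ext j
        · simp [this, hwi]
        · simp [this, hwi]
      right_inv := fun k => by
        ext j
        simp }
  have h1 : (relMeasure φ S).IsAddHaarMeasure := isAddHaarMeasure_hausdorffMeasure
  have h2 : (relMeasure φ (S.erase i)).IsAddHaarMeasure := isAddHaarMeasure_hausdorffMeasure
  let E := e.toContinuousLinearEquiv
  have h3 := E.isAddHaarMeasure_map ((relMeasure φ (S.erase i)).prod volume)
  obtain ⟨c, hc⟩ : ∃ c : NNReal, relMeasure φ S =
      c • Measure.map E ((relMeasure φ (S.erase i)).prod volume) :=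
    ⟨_, Measure.isAddLeftInvariant_eq_smul _ _⟩
  refine ⟨c, fun a t => ?_⟩
  obtain ⟨x, hx, rfl⟩ := hS a
  have hxi : x i = 0 := hx i (by simp)
  have hxS : ∀ j, j ∉ S → x j = 0 := fun j hj => hx j (fun h => hj (Finset.mem_of_mem_erase h))
  have hne : ∀ {j}, j ∉ S → j ≠ i := fun hj h => hj (h ▸ hiS)
  have hv : lcMap φ x + t • φ i = lcMap φ (x + Pi.single i t) := by rw [map_add, hsingle]
  rw [hv, volOn_eq _ (fun j hj => by simp [hxS j hj, hne hj]), hc]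
  have hclosed := isClosed_shifted (φ := φ) (S := S) (x + Pi.single i t)
  rw [Measure.smul_apply, ENNReal.smul_def, smul_eq_mul,
    Measure.map_apply E.continuous.measurable hclosed.measurableSet,
    Measure.prod_apply_symm (E.continuous.measurable hclosed.measurableSet),
    ← lintegral_indicator measurableSet_Iic]
  congr 1
  refine lintegral_congr fun s => ?_
  have hslice : (fun k => (k, s)) ⁻¹' (E ⁻¹' {k | ∀ j, 0 ≤ k.1 j + (x + Pi.single i t : _ → ℝ) j})
      = {k | ∀ j, 0 ≤ k.1 j + s * w j + (x j + (Pi.single i t : _ → ℝ) j)} := rfl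
  rw [hslice]
  by_cases hst : s ≤ t
  · rw [Set.indicator_of_mem (Set.mem_Iic.2 hst)]
    have hv' : lcMap φ x + s • φ i = lcMap φ (x + s • w + Pi.single i s) := by
      rw [map_add, map_add, hsingle, map_smul, hw.2, smul_zero, add_zero]
    rw [hv', volOn_eq _ (fun j hj => by
      rw [Finset.mem_erase, not_and_or, not_not] at hj
      rcases hj with rfl | hj
      · simp [hxi, hwi]
      · simp [hxS j hj, hw.1 j hj, hne hj])]
    congr 1
    ext k
    refine forall_congr' fun j => ?_
    rcases eq_or_ne j i with rfl | hj
    · have hk := k.2.1 j (by simp)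
      simp [hk, hwi, hxi, hst]
    · simp [hj, add_assoc, add_comm]
  · rw [Set.indicator_of_notMem (by simpa using hst)]
    convert measure_empty (μ := relMeasure φ (S.erase i))
    refine Set.eq_empty_of_forall_notMem fun k hk => hst ?_
    have h := hk i
    simp only [k.2.1 i (by simp), hwi, hxi, Pi.single_eq_same] at h
    linarith

lemma volOn_sub_eq_integral {i : Fin N} {c : NNReal} {U : Set (Fin r → ℝ)} (hU : Convex ℝ U)
    {Q : MvPolynomial (Fin r) ℝ} (hfin : ∀ a, volOn φ S a < ⊤)
    (hfin' : ∀ a, volOn φ (S.erase i) a < ⊤)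
    (hc : ∀ (a : Fin r → ℝ) (t : ℝ),
      volOn φ S (a + t • φ i) = c * ∫⁻ s in Set.Iic t, volOn φ (S.erase i) (a + s • φ i))
    (hQ : ∀ a ∈ U, (volOn φ (S.erase i) a).toReal = MvPolynomial.eval a Q)
    {a : Fin r → ℝ} (ha : a ∈ U) {t : ℝ} (hat : a + t • φ i ∈ U) :
    (volOn φ S (a + t • φ i)).toReal - (volOn φ S a).toReal =
      ∫ s in (0 : ℝ)..t, MvPolynomial.eval (a + s • φ i) (MvPolynomial.C (c : ℝ) * Q) := by
  have key : ∀ a ∈ U, ∀ t : ℝ, 0 ≤ t → a + t • φ i ∈ U →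
      (volOn φ S (a + t • φ i)).toReal - (volOn φ S a).toReal =
        ∫ s in (0 : ℝ)..t, MvPolynomial.eval (a + s • φ i) (MvPolynomial.C (c : ℝ) * Q) := by
    intro a ha t ht hat
    have hseg : ∀ s ∈ Set.Ioc 0 t, a + s • φ i ∈ U := fun s hs => by
      have htpos : 0 < t := hs.1.trans_le hs.2
      have h := hU.add_smul_mem ha hat (t := s / t)
        ⟨div_nonneg hs.1.le ht, (div_le_one htpos).2 hs.2⟩
      rwa [smul_smul, div_mul_cancel₀ _ htpos.ne'] at h
    have h0 := hc a 0
    rw [zero_smul, add_zero] at h0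
    have hcont : Continuous fun s : ℝ => MvPolynomial.eval (a + s • φ i) Q :=
      (MvPolynomial.continuous_eval Q).comp (by fun_prop)
    have hint : ∫⁻ s in Set.Ioc 0 t, volOn φ (S.erase i) (a + s • φ i) =
        ENNReal.ofReal (∫ s in Set.Ioc 0 t, MvPolynomial.eval (a + s • φ i) Q) := by
      rw [ofReal_integral_eq_lintegral_ofReal
        (hcont.integrableOn_Icc.mono_set Set.Ioc_subset_Icc_self)]
      · refine setLIntegral_congr_fun measurableSet_Ioc fun s hs => ?_
        rw [← hQ _ (hseg s hs), ENNReal.ofReal_toReal (hfin' _).ne]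
      · refine (ae_restrict_iff' measurableSet_Ioc).2 (Eventually.of_forall fun s hs => ?_)
        simp only [Pi.zero_apply]
        rw [← hQ _ (hseg s hs)]
        exact ENNReal.toReal_nonneg
    have hnn : 0 ≤ ∫ s in Set.Ioc 0 t, MvPolynomial.eval (a + s • φ i) Q := by
      refine setIntegral_nonneg measurableSet_Ioc fun s hs => ?_
      rw [← hQ _ (hseg s hs)]
      exact ENNReal.toReal_nonneg
    have h1 : volOn φ S (a + t • φ i) = volOn φ S a +
        c * ENNReal.ofReal (∫ s in Set.Ioc 0 t, MvPolynomial.eval (a + s • φ i) Q) := by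
      rw [h0, hc a t, ← Set.Iic_union_Ioc_eq_Iic ht, lintegral_union measurableSet_Ioc
        (Set.Iic_disjoint_Ioc le_rfl), mul_add, hint]
    rw [h1, ENNReal.toReal_add (hfin a).ne (by finiteness), add_sub_cancel_left,
      ENNReal.toReal_mul, ENNReal.toReal_ofReal hnn, intervalIntegral.integral_of_le ht,
      ENNReal.coe_toReal, ← integral_const_mul]
    simp
  rcases le_total 0 t with ht | ht
  · exact key a ha t ht hat
  · have h := key (a + t • φ i) hat (-t) (neg_nonneg.2 ht) (by simpa [add_assoc] using ha)
    have hshift := intervalIntegral.integral_comp_add_right (a := 0) (b := -t)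
      (fun s : ℝ => MvPolynomial.eval (a + s • φ i) (MvPolynomial.C (c : ℝ) * Q)) t
    rw [intervalIntegral.integral_symm, ← neg_sub, neg_inj]
    rw [add_assoc, ← add_smul, add_neg_cancel, zero_smul, add_zero] at h
    rw [h]
    simp only [zero_add, neg_add_cancel] at hshift
    rw [← hshift]
    refine intervalIntegral.integral_congr fun s _ => ?_
    simp only [add_smul, add_assoc, add_comm (t • φ i)]

/-- The volume is invariant along `φ i` when `i` belongs to no relation. -/
lemma volOn_add_smul_of_not_spansOn_erase {i : Fin N} (hiS : i ∈ S) (hS : SpansOn φ S)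
    (hi : ¬ SpansOn φ (S.erase i)) {a : Fin r → ℝ} (ha : a ∈ coneOf φ S) {t : ℝ}
    (hat : a + t • φ i ∈ coneOf φ S) : volOn φ S (a + t • φ i) = volOn φ S a := by
  have hz : ∀ k ∈ relSpace φ S, k i = 0 := fun k hk => by
    by_contra h
    exact hi (hS.erase hk h)
  obtain ⟨x, hx0, hxS, rfl⟩ := mem_coneOf.1 ha
  obtain ⟨y, hy0, hyS, hy⟩ := mem_coneOf.1 hat
  have hv : lcMap φ x + t • φ i = lcMap φ (x + Pi.single i t) := by
    rw [map_add, Fintype.linearCombination_apply_single]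
  have hne : ∀ {j}, j ∉ S → j ≠ i := fun hj h => hj (h ▸ hiS)
  have hyi : y i = x i + t := by
    have := hz (y - (x + Pi.single i t))
      ⟨fun j hj => by simp [hyS j hj, hxS j hj, hne hj], by rw [map_sub, hy, hv, sub_self]⟩
    simp only [Pi.sub_apply, Pi.add_apply, Pi.single_eq_same] at this
    linarith
  rw [hv, volOn_eq _ (fun j hj => by simp [hxS j hj, hne hj]), volOn_eq x hxS]
  congr 1
  ext k
  refine forall_congr' fun j => ?_
  rcases eq_or_ne j i with rfl | hj
  · have := hy0 j
    simp only [hz _ k.2, Pi.add_apply, Pi.single_eq_same, zero_add, ← hyi, hx0, hy0]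
  · simp [hj]

lemma volOn_smul (hS : SpansOn φ S) (a : Fin r → ℝ) {t : ℝ} (ht : 0 < t) :
    volOn φ S (t • a) =
      ENNReal.ofReal (t ^ Module.finrank ℝ (relSpace φ S)) * volOn φ S a := by
  obtain ⟨x, hx, rfl⟩ := hS a
  have h1 : (relMeasure φ S).IsAddHaarMeasure := isAddHaarMeasure_hausdorffMeasure
  rw [← map_smul, volOn_eq _ (fun j hj => by simp [hx j hj]), volOn_eq x hx,
    ← abs_of_pos (pow_pos ht _), ← Measure.addHaar_smul]
  congr 1
  ext k
  rw [Set.mem_smul_set_iff_inv_smul_mem₀ ht.ne']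
  refine forall_congr' fun j => ?_
  have : k.1 j + (t • x) j = t * ((t⁻¹ • k).1 j + x j) := by
    simp
    field_simp
  rw [this, mul_nonneg_iff_of_pos_left ht]

lemma volOn_eq_of_relSpace_eq_bot (h : relSpace φ S = ⊥) {a : Fin r → ℝ} (ha : a ∈ coneOf φ S) :
    volOn φ S a = relMeasure φ S Set.univ := by
  obtain ⟨x, hx0, hxS, rfl⟩ := mem_coneOf.1 ha
  rw [volOn_eq x hxS]
  congr 1
  refine Set.eq_univ_of_forall fun k j => ?_
  have : k.1 = 0 := by simpa [h] using k.2
  simp [this, hx0]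

lemma tendsto_volOn (hS : SpansOn φ S)
    (hpointed : ∀ x : Fin N → ℝ, (∀ i, 0 ≤ x i) → (∑ i, x i • φ i) = 0 → x = 0)
    (a : Fin r → ℝ) {u : Fin r → ℝ} (hu : u ∈ coneOf φ S) :
    Tendsto (fun n : ℕ => volOn φ S (a + (1 / ((n : ℝ) + 1)) • u)) atTop (𝓝 (volOn φ S a)) := by
  obtain ⟨x, hx, rfl⟩ := hS a
  obtain ⟨y, hy0, hy, rfl⟩ := mem_coneOf.1 hu
  have h := tendsto_measure_iInter_atTop (μ := relMeasure φ S)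
    (s := fun n : ℕ => {k | ∀ i, 0 ≤ k.1 i + (x + (1 / ((n : ℝ) + 1)) • y) i})
    (fun n => (isClosed_shifted _).measurableSet.nullMeasurableSet)
    (fun m n hmn k hk i => (hk i).trans (by
      have := mul_le_mul_of_nonneg_right (Nat.one_div_le_one_div (α := ℝ) hmn) (hy0 i)
      simp only [Pi.add_apply, Pi.smul_apply, smul_eq_mul]
      linarith))
    ⟨0, (relMeasure_shifted_lt_top hpointed _).ne⟩
  have hI : ⋂ n : ℕ, {k : relSpace φ S | ∀ i, 0 ≤ k.1 i + (x + (1 / ((n : ℝ) + 1)) • y) i} =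
      {k | ∀ i, 0 ≤ k.1 i + x i} := by
    ext k
    simp only [Set.mem_iInter, Set.mem_ofPred_eq]
    constructor
    · intro hk i
      have ht : Tendsto (fun n : ℕ => k.1 i + (x + (1 / ((n : ℝ) + 1)) • y) i) atTop
          (𝓝 (k.1 i + (x i + 0 * y i))) :=
        ((tendsto_one_div_add_atTop_nhds_zero_nat.mul_const (y i)).const_add (x i)).const_add _
      have := ge_of_tendsto' ht (fun n => hk n i)
      simpa using this
    · intro hk n i
      have : 0 ≤ 1 / ((n : ℝ) + 1) * y i := mul_nonneg (by positivity) (hy0 i)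
      have := hk i
      simp only [Pi.add_apply, Pi.smul_apply, smul_eq_mul]
      linarith
  rw [hI, ← volOn_eq x hx] at h
  refine h.congr fun n => ?_
  rw [← map_smul, ← map_add, volOn_eq _ (fun j hj => by simp [hx j hj, hy j hj])]
  rfl

end

/-- A function whose increments along each `b i` are integrals of a continuous function `q i`
is differentiable along every combination of the `b i`. -/
lemma hasDerivAt_of_sub_eq_integral {ι E : Type*} [NormedAddCommGroup E] [NormedSpace ℝ E]
    {U : Set E} (hU : IsOpen U) {f : E → ℝ} (b : ι → E) (q : ι → E → ℝ) (T : Finset ι)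
    (hq : ∀ i ∈ T, Continuous (q i))
    (hf : ∀ i ∈ T, ∀ a ∈ U, ∀ t : ℝ, a + t • b i ∈ U →
      f (a + t • b i) - f a = ∫ s in (0 : ℝ)..t, q i (a + s • b i))
    {a : E} (ha : a ∈ U) (l : ι → ℝ) :
    HasDerivAt (fun t : ℝ => f (a + t • ∑ i ∈ T, l i • b i)) (∑ i ∈ T, l i * q i a) 0 := by
  induction T using Finset.cons_induction with
  | empty => simpa using hasDerivAt_const (0 : ℝ) (f a)
  | cons i T hi ih =>
    have ih' := ih (fun j hj => hq j (Finset.mem_cons_of_mem hj))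
      (fun j hj => hf j (Finset.mem_cons_of_mem hj))
    set v := ∑ i ∈ T, l i • b i with hv
    have hqi := hq i (Finset.mem_cons_self i T)
    set h : ℝ → ℝ := fun t => ∫ s in (0 : ℝ)..1, q i (a + t • v + (t * l i * s) • b i) with hh
    have hcont : Continuous h := by
      refine intervalIntegral.continuous_parametric_intervalIntegral_of_continuous' ?_ 0 1
      exact hqi.comp (by fun_prop)
    have h0 : h 0 = q i a := by simp [hh]
    have hderiv : HasDerivAt (fun t : ℝ => t * (l i * h t)) (l i * q i a) 0 := by
      rw [hasDerivAt_iff_tendsto_slope, ← h0]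
      have : Tendsto (fun t => l i * h t) (𝓝[≠] 0) (𝓝 (l i * h 0)) :=
        ((hcont.const_mul (l i)).tendsto 0).mono_left nhdsWithin_le_nhds
      refine this.congr' ?_
      filter_upwards [self_mem_nhdsWithin] with t ht
      have ht' : t ≠ 0 := ht
      simp [slope, ht']
    rw [Finset.sum_cons (f := fun i => l i * q i a), add_comm]
    refine (ih'.add hderiv).congr_of_eventuallyEq ?_
    have hmem1 : ∀ᶠ t : ℝ in 𝓝 0, a + t • v ∈ U := by
      have hc : Continuous fun t : ℝ => a + t • v := by fun_prop
      exact hc.continuousAt.eventually_mem (hU.mem_nhds (by simpa using ha))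
    have hmem2 : ∀ᶠ t : ℝ in 𝓝 0, a + t • v + (t * l i) • b i ∈ U := by
      have hc : Continuous fun t : ℝ => a + t • v + (t * l i) • b i := by fun_prop
      exact hc.continuousAt.eventually_mem (hU.mem_nhds (by simpa using ha))
    filter_upwards [hmem1, hmem2] with t ht1 ht2
    have hd := hf i (Finset.mem_cons_self i T) _ ht1 _ ht2
    have hscale := intervalIntegral.mul_integral_comp_mul_left (a := 0) (b := 1)
      (f := fun s => q i (a + t • v + s • b i)) (t * l i)
    rw [mul_zero, mul_one, ← hd] at hscale
    have he : a + t • ∑ j ∈ Finset.cons i T hi, l j • b j = a + t • v + (t * l i) • b i := by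
      rw [Finset.sum_cons, smul_add, smul_smul, ← hv]
      abel
    simp only [Pi.add_apply, he]
    rw [← mul_assoc]
    linarith

lemma exists_mvPolynomial_eval_eq {r : ℕ} (l : (Fin r → ℝ) →ₗ[ℝ] ℝ) :
    ∃ P : MvPolynomial (Fin r) ℝ, ∀ a, MvPolynomial.eval a P = l a := by
  refine ⟨∑ j, MvPolynomial.C (l (Pi.single j 1)) * MvPolynomial.X j, fun a => ?_⟩
  simp only [map_sum, map_mul, MvPolynomial.eval_C, MvPolynomial.eval_X]
  conv_rhs => rw [← LinearMap.sum_single_apply (fun _ => ℝ) a, map_sum]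
  refine Finset.sum_congr rfl fun j _ => ?_
  rw [show (Pi.single j (a j) : Fin r → ℝ) = a j • Pi.single j 1 by
    rw [← Pi.single_smul, smul_eq_mul, mul_one], map_smul, smul_eq_mul, mul_comm]

section

variable {N r : ℕ} {φ : Fin N → (Fin r → ℝ)} {S : Finset (Fin N)}

lemma SpansOn.exists_linear_section (hS : SpansOn φ S) :
    ∃ s : (Fin r → ℝ) →ₗ[ℝ] (Fin N → ℝ), ∀ a, ∑ i ∈ S, s a i • φ i = a := by
  let L : (Fin N → ℝ) →ₗ[ℝ] (Fin r → ℝ) := ∑ i ∈ S, (LinearMap.proj i).smulRight (φ i)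
  have hL : ∀ x, L x = ∑ i ∈ S, x i • φ i := fun x => by simp [L]
  have hsurj : Function.Surjective L := fun a => by
    obtain ⟨x, hx, rfl⟩ := hS a
    refine ⟨x, ?_⟩
    rw [hL, Fintype.linearCombination_apply]
    exact Finset.sum_subset (Finset.subset_univ S) (fun i _ hi => by simp [hx i hi])
  obtain ⟨s, hs⟩ := L.exists_rightInverse_of_surjective (LinearMap.range_eq_top.2 hsurj)
  refine ⟨s, fun a => ?_⟩
  rw [← hL]
  exact LinearMap.congr_fun hs a

lemma IsChamber.exists_volOn_eq_eval {I : Set (Finset (Fin N))} (hI : IsChamber φ I)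
    (hpointed : ∀ x : Fin N → ℝ, (∀ i, 0 ≤ x i) → (∑ i, x i • φ i) = 0 → x = 0)
    (hS : SpansOn φ S) :
    ∃ P : MvPolynomial (Fin r) ℝ, ∀ a ∈ interior (Fcone φ I),
      (volOn φ S a).toReal = MvPolynomial.eval a P := by
  induction S using Finset.strongInduction with
  | H S ih =>
    by_cases hne : (interior (Fcone φ I) ∩ coneOf φ S).Nonempty
    swap
    · refine ⟨0, fun a ha => ?_⟩
      rw [volOn_eq_zero fun h => hne ⟨a, ha, h⟩]
      simp
    have hsub : interior (Fcone φ I) ⊆ coneOf φ S :=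
      interior_subset.trans (hI.subset_coneOf hpointed hS hne)
    by_cases hbot : relSpace φ S = ⊥
    · refine ⟨MvPolynomial.C (relMeasure φ S Set.univ).toReal, fun a ha => ?_⟩
      rw [volOn_eq_of_relSpace_eq_bot hbot (hsub ha), MvPolynomial.eval_C]
    have hD : Module.finrank ℝ (relSpace φ S) ≠ 0 := fun h => hbot (Submodule.finrank_eq_zero.1 h)
    set D := Module.finrank ℝ (relSpace φ S) with hDdef
    have hQ : ∀ i ∈ S, ∃ Q : MvPolynomial (Fin r) ℝ, ∀ a ∈ interior (Fcone φ I), ∀ t : ℝ,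
        a + t • φ i ∈ interior (Fcone φ I) →
        (volOn φ S (a + t • φ i)).toReal - (volOn φ S a).toReal =
          ∫ s in (0 : ℝ)..t, MvPolynomial.eval (a + s • φ i) Q := by
      intro i hi
      by_cases hSi : SpansOn φ (S.erase i)
      · obtain ⟨Q, hQ⟩ := ih _ (Finset.erase_ssubset hi) hSi
        obtain ⟨c, hc⟩ := exists_volOn_add_smul_eq_lintegral hi hSi
        exact ⟨MvPolynomial.C (c : ℝ) * Q, fun a ha t hat =>
          volOn_sub_eq_integral convex_Fcone.interior (volOn_lt_top hS hpointed)
            (volOn_lt_top hSi hpointed) hc hQ ha hat⟩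
      · refine ⟨0, fun a ha t hat => ?_⟩
        rw [volOn_add_smul_of_not_spansOn_erase hi hS hSi (hsub ha) (hsub hat)]
        simp
    choose! Q hQ using hQ
    obtain ⟨s, hs⟩ := hS.exists_linear_section
    choose l hl using fun i => exists_mvPolynomial_eval_eq (LinearMap.proj i ∘ₗ s)
    refine ⟨MvPolynomial.C (D : ℝ)⁻¹ * ∑ i ∈ S, l i * Q i, fun a ha => ?_⟩
    have h1 := hasDerivAt_of_sub_eq_integral isOpen_interior (f := fun a => (volOn φ S a).toReal)
      φ (fun i a => MvPolynomial.eval a (Q i)) S (fun i _ => MvPolynomial.continuous_eval _)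
      hQ ha (s a)
    rw [hs] at h1
    have h2 : HasDerivAt (fun t : ℝ => (volOn φ S (a + t • a)).toReal)
        (D * (volOn φ S a).toReal) 0 := by
      have h3 : HasDerivAt (fun t : ℝ => (1 + t) ^ D * (volOn φ S a).toReal)
          (D * (volOn φ S a).toReal) 0 := by
        have := ((((hasDerivAt_id (0 : ℝ)).const_add 1).pow D).mul_const (volOn φ S a).toReal)
        simpa using this
      refine h3.congr_of_eventuallyEq ?_
      filter_upwards [lt_mem_nhds (show (-1 : ℝ) < 0 by norm_num)] with t ht
      have hpos : 0 < 1 + t := by linarith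
      rw [show a + t • a = (1 + t) • a by rw [add_smul, one_smul], volOn_smul hS a hpos,
        ENNReal.toReal_mul, ENNReal.toReal_ofReal (by positivity)]
    have h4 := h2.unique h1
    simp only [map_mul, map_sum, MvPolynomial.eval_C, hl, LinearMap.comp_apply,
      LinearMap.proj_apply]
    rw [← h4, inv_mul_cancel_left₀ (Nat.cast_ne_zero.2 hD)]

end

lemma finrank_relSpace_univ {N r : ℕ} {φ : Fin N → (Fin r → ℝ)} (h : SpansOn φ Finset.univ) :
    Module.finrank ℝ (relSpace φ Finset.univ) = N - r := by
  have hker : relSpace φ Finset.univ = (lcMap φ).ker := by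
    ext x
    simp [mem_relSpace]
  have hr : (lcMap φ).range = ⊤ := LinearMap.range_eq_top.2 fun a => by
    obtain ⟨x, -, hx⟩ := h a
    exact ⟨x, hx⟩
  have := LinearMap.finrank_range_add_finrank_ker (lcMap φ)
  rw [hr, finrank_top, Module.finrank_fin_fun, Module.finrank_fin_fun] at this
  rw [hker]
  omega

/-- on each chamber, the volume (the `(N-r)`-dimensional Hausdorff measure)
of the polytope `P(Φ,a)` is given by a polynomial in `a`. -/
theorem volume_polynomial_on_chamber
    {N r : ℕ} (φ : Fin N → (Fin r → ℝ)) (hφ : ∀ i, φ i ≠ 0)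
    (hspan : Submodule.span ℝ (Set.range φ) = ⊤)
    (hpointed : ∀ x : Fin N → ℝ, (∀ i, 0 ≤ x i) → (∑ i, x i • φ i) = 0 → x = 0)
    (I : Set (Finset (Fin N))) (hI : IsChamber φ I) :
    ∃ P : MvPolynomial (Fin r) ℝ, ∀ a ∈ Fcone φ I,
      MeasureTheory.Measure.hausdorffMeasure (((N - r : ℕ) : ℝ))
          {x : Fin N → ℝ | (∀ i, 0 ≤ x i) ∧ (∑ i, x i • φ i) = a}
        = ENNReal.ofReal (MvPolynomial.eval a P) := by
  have hS : SpansOn φ Finset.univ := fun a => by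
    have ha : a ∈ Submodule.span ℝ (Set.range φ) := hspan ▸ trivial
    obtain ⟨x, hx⟩ := (Submodule.mem_span_range_iff_exists_fun ℝ).1 ha
    exact ⟨x, fun i hi => absurd (Finset.mem_univ i) hi, hx⟩
  obtain ⟨P, hP⟩ := hI.exists_volOn_eq_eval hpointed hS
  have hvol : ∀ a, MeasureTheory.Measure.hausdorffMeasure (((N - r : ℕ) : ℝ))
      {x : Fin N → ℝ | (∀ i, 0 ≤ x i) ∧ (∑ i, x i • φ i) = a} = volOn φ Finset.univ a := by
    intro a
    rw [volOn, finrank_relSpace_univ hS]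
    congr 1
    ext x
    simp [polytopeOn, Fintype.linearCombination_apply]
  refine ⟨P, fun a ha => ?_⟩
  obtain ⟨u, hu⟩ := hI.2.1
  have hne : (interior (Fcone φ I) ∩ coneOf φ Finset.univ).Nonempty := by
    rcases I.eq_empty_or_nonempty with rfl | ⟨σ, hσ⟩
    · exact ⟨0, by simp [Fcone], mem_coneOf.2 ⟨0, fun _ => le_rfl, fun _ _ => rfl, map_zero _⟩⟩
    · exact ⟨u, hu, coneOf_mono (Finset.subset_univ σ)
        (Set.mem_iInter₂.1 (interior_subset hu) σ hσ)⟩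
  have hlim := tendsto_volOn hS hpointed a
    (hI.subset_coneOf hpointed hS hne (interior_subset hu))
  have hlim' := (ENNReal.tendsto_toReal (volOn_lt_top hS hpointed a).ne).comp hlim
  have hPlim : Tendsto (fun n : ℕ => MvPolynomial.eval (a + (1 / ((n : ℝ) + 1)) • u) P) atTop
      (𝓝 (MvPolynomial.eval (a + (0 : ℝ) • u) P)) :=
    ((MvPolynomial.continuous_eval P).tendsto _).comp
      ((tendsto_one_div_add_atTop_nhds_zero_nat.smul_const u).const_add a)
  rw [zero_smul, add_zero] at hPlim
  have heq := tendsto_nhds_unique hlim' (hPlim.congr fun n =>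
    (hP _ (add_smul_mem_interior_Fcone ha hu (by positivity))).symm)
  rw [hvol, ← heq, ENNReal.ofReal_toReal (volOn_lt_top hS hpointed a).ne]

end
end
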